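/- arXiv:1701.00362 — 8 statements merged into one kernel-verified Lean document; each statement's English description precedes it below -/
import Mathlib

section
/- Let S be a finite set and let A = (A_j)_{j ∈ J} be a finite family of subsets of S (J finite). Assume A has at least one transversal, i.e. there is an injective map f : J → S with f(j) ∈ A_j for all j. Then the collection of all transversals of A (sets of the form {f(j) : j ∈ J} for injective f with f(j) ∈ A_j for all j) is the collection of bases of a matroid on S; equivalently, this collection is nonempty and satisfies the base exchange axiom: for distinct transversals B, B' and each x ∈ B \ B', there is y ∈ B' \ B with (B \ {x}) ∪ {y} again a transversal. -/
/-- A nonempty collection of finite sets forms the bases of a matroid if it satisfies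
the base exchange axiom. -/
def IsMatroidBases {α : Type*} [DecidableEq α] (Bs : Set (Finset α)) : Prop :=
  Bs.Nonempty ∧ ∀ B ∈ Bs, ∀ B' ∈ Bs, B ≠ B' → ∀ x ∈ B \ B',
    ∃ y ∈ B' \ B, insert y (B.erase x) ∈ Bs

/-- A transversal of the set system `A = (A j)_{j : J}`: a set of `|J|` distinct
elements, one from each `A j`. -/
def IsTransversal {S J : Type*} [Fintype J] [DecidableEq S]
    (A : J → Finset S) (T : Finset S) : Prop :=
  ∃ f : J → S, Function.Injective f ∧ (∀ j, f j ∈ A j) ∧ T = Finset.image f Finset.univ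

/-- Exchange property for injections: an element `f i` of `range f` that is missed by `g` can be
replaced by an element of `range g`, using at each index a value of `f` or of `g`. -/
theorem exists_injective_exchange {S J : Type*} [Finite J] {f g : J → S}
    (hf : Function.Injective f) (hg : Function.Injective g) {i : J} (hi : f i ∉ Set.range g) :
    ∃ y ∈ Set.range g \ Set.range f, ∃ h : J → S, Function.Injective h ∧
      (∀ j, h j = f j ∨ h j = g j) ∧ Set.range h = insert y (Set.range f \ {f i}) := by
  classical
  induction hn : {j | f j ≠ g j}.ncard using Nat.strong_induction_on generalizing f i with
  | _ n ih =>
  by_cases hgi : g i ∈ Set.range f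
  · obtain ⟨k, hk⟩ := hgi
    have hki : k ≠ i := by
      rintro rfl
      exact hi ⟨k, hk.symm⟩
    have hlt : {j | (f ∘ Equiv.swap i k) j ≠ g j}.ncard < n := by
      rw [← hn]
      refine Set.ncard_lt_ncard ⟨fun j hj => ?_, fun hsub => ?_⟩ (Set.toFinite _)
      · by_cases hji : j = i
        · simp [hji, hk] at hj
        by_cases hjk : j = k
        · subst hjk
          exact fun h => hki (hg (h.symm.trans hk))
        simpa [Equiv.swap_apply_of_ne_of_ne hji hjk] using hj
      · have hmem : i ∈ {j | f j ≠ g j} := fun h => hi ⟨i, h.symm⟩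
        simpa [hk] using hsub hmem
    have hrange : Set.range (f ∘ Equiv.swap i k) = Set.range f := by simp [Set.range_comp]
    obtain ⟨y, hy, h, hinj, hval, hr⟩ :=
      ih _ hlt (f := f ∘ Equiv.swap i k) (i := k) (hf.comp (Equiv.injective _))
        (by simpa using hi) rfl
    rw [hrange] at hy hr
    refine ⟨y, hy, h, hinj, fun j => ?_, by simpa using hr⟩
    by_cases hji : j = i
    · subst hji
      right
      simpa [hk] using hval j
    by_cases hjk : j = k
    · subst hjk
      refine Or.inr ((hval j).resolve_left fun hx => ?_)
      have hmem : h j ∈ Set.range h := ⟨j, rfl⟩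
      rw [hr, hx] at hmem
      rcases hmem with hmem | hmem
      · rw [← hmem] at hy
        exact hi (by simpa using hy.1)
      · exact hmem.2 rfl
    simpa [Equiv.swap_apply_of_ne_of_ne hji hjk] using hval j
  · refine ⟨g i, ⟨⟨i, rfl⟩, hgi⟩, Function.update f i (g i), fun a b hab => ?_, fun j => ?_, ?_⟩
    · simp only [Set.mem_range, not_exists] at hgi
      grind [Function.Injective]
    · grind
    · ext s
      simp only [Set.mem_range, Set.mem_insert_iff, Set.mem_sdiff, Set.mem_singleton_iff]
      constructor
      · rintro ⟨j, rfl⟩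
        by_cases hj : j = i
        · simp [hj]
        · simp [hj, hf.eq_iff]
      · rintro (rfl | ⟨⟨j, rfl⟩, hj⟩)
        · exact ⟨i, by simp⟩
        · exact ⟨j, Function.update_of_ne (fun hji => hj (congrArg f hji)) _ _⟩

/-- The transversals of a set system with at least one transversal form the bases
of a matroid. -/
theorem transversals_form_matroid_bases {S J : Type*} [Fintype S] [Fintype J]
    [DecidableEq S] (A : J → Finset S)
    (hne : ∃ f : J → S, Function.Injective f ∧ ∀ j, f j ∈ A j) :
    IsMatroidBases {T : Finset S | IsTransversal A T} := by
  obtain ⟨f₀, hf₀, hA₀⟩ := hne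
  refine ⟨⟨_, f₀, hf₀, hA₀, rfl⟩, ?_⟩
  rintro _ ⟨f, hf, hfA, rfl⟩ _ ⟨g, hg, hgA, rfl⟩ - x hx
  simp only [Finset.mem_sdiff, Finset.mem_image, Finset.mem_univ, true_and] at hx
  obtain ⟨⟨i, rfl⟩, hi⟩ := hx
  obtain ⟨y, hy, h, hinj, hval, hr⟩ := exists_injective_exchange hf hg hi
  refine ⟨y, by simpa using hy, h, hinj, fun j => ?_, ?_⟩
  · rcases hval j with hj | hj
    · exact hj ▸ hfA j
    · exact hj ▸ hgA j
  · apply Finset.coe_injective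
    simp [hr]
end

section
/- Let P = p_1⋯p_{m+r} and Q = q_1⋯q_{m+r} be lattice paths from (0,0) to (m,r) with P never going above Q. Let u_1 < u_2 < ⋯ < u_r be the positions of the N steps of P and l_1 < l_2 < ⋯ < l_r the positions of the N steps of Q, and set N_i = [l_i, u_i] = {l_i, l_i+1, …, u_i} for i ∈ {1,…,r}. Then for a subset B ⊆ {1,…,m+r} with |B| = r, B is a transversal of the set system {N_i : 1 ≤ i ≤ r} if and only if N(P,i) ≤ |B ∩ {1,…,i}| ≤ N(Q,i) for every i ∈ {1,…,m+r} (i.e., the lattice path having N steps exactly at the positions in B stays in the region bounded by P and Q). -/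
/-- Number of North steps among the first `i` steps of the lattice path `P`
(steps are indexed `1, …, n`; `P j = true` means step `j` is a North step). -/
def NCt (P : ℕ → Bool) (i : ℕ) : ℕ :=
  ((Finset.Icc 1 i).filter (fun j => P j = true)).card

/-- `P` is a lattice path from `(0,0)` to `(m,r)`: it has exactly `r` North steps
among its `m + r` steps. -/
def IsPath (m r : ℕ) (P : ℕ → Bool) : Prop := NCt P (m + r) = r

/-- `P` never goes above `Q`. -/
def Below (n : ℕ) (P Q : ℕ → Bool) : Prop := ∀ i ≤ n, NCt P i ≤ NCt Q i

/-- `B` is a basis of the lattice path matroid `M[P,Q]`: an `r`-element subset of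
`{1, …, m+r}` whose associated lattice path stays between `P` and `Q`. -/
def IsLPBasis (m r : ℕ) (P Q : ℕ → Bool) (B : Finset ℕ) : Prop :=
  B ⊆ Finset.Icc 1 (m + r) ∧ B.card = r ∧
    ∀ i ≤ m + r, NCt P i ≤ (B.filter (fun j => j ≤ i)).card ∧
      (B.filter (fun j => j ≤ i)).card ≤ NCt Q i

/-- The 0/1 indicator vector in `ℝ^n` of a subset `B ⊆ {1, …, n}`. -/
def ind (n : ℕ) (B : Finset ℕ) : Fin n → ℝ :=
  fun i => if (i : ℕ) + 1 ∈ B then 1 else 0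

/-- The lattice path matroid polytope: the convex hull of the indicator vectors of
the bases of `M[P,Q]`. -/
def LPMPoly (m r : ℕ) (P Q : ℕ → Bool) : Set (Fin (m + r) → ℝ) :=
  convexHull ℝ (ind (m + r) '' {B | IsLPBasis m r P Q B})

/-- `F` is a face of `S`: a convex subset such that whenever a point of `F` lies in
the open segment between two points of `S`, both endpoints lie in `F`. -/
def IsFace {n : ℕ} (S F : Set (Fin n → ℝ)) : Prop :=
  F ⊆ S ∧ Convex ℝ F ∧
    ∀ x ∈ S, ∀ y ∈ S, ∀ z ∈ openSegment ℝ x y, z ∈ F → x ∈ F ∧ y ∈ F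

/-- The dimension of the affine hull of a set in `ℝ^n`. -/
noncomputable def fdim {n : ℕ} (F : Set (Fin n → ℝ)) : ℕ :=
  Module.finrank ℝ (affineSpan ℝ F).direction

/-- A facet: a nonempty face whose dimension is one less than that of the polytope. -/
def IsFacet {n : ℕ} (S F : Set (Fin n → ℝ)) : Prop :=
  F.Nonempty ∧ IsFace S F ∧ fdim F + 1 = fdim S

/-- The elements at most `i` of the image of an injective map are counted by their indices. -/
theorem card_filter_image_le {r : ℕ} {f : Fin r → ℕ} (hf : Function.Injective f) (i : ℕ) :
    ((Finset.image f Finset.univ).filter (fun j => j ≤ i)).card =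
      (Finset.univ.filter (fun k => f k ≤ i)).card := by
  rw [Finset.filter_image, Finset.card_image_of_injective _ hf]

/-- If `u` enumerates the North-step positions of `P` in `{1, …, n}`, then `NCt P i` counts the
indices `k` with `u k ≤ i`. -/
theorem NCt_eq_card_filter_le {n r : ℕ} {P : ℕ → Bool} {u : Fin r → ℕ}
    (hu : Function.Injective u) (hu_mem : ∀ k, u k ∈ Finset.Icc 1 n ∧ P (u k) = true)
    (hu_all : ∀ j ∈ Finset.Icc 1 n, P j = true → ∃ k, u k = j) {i : ℕ} (hi : i ≤ n) :
    NCt P i = (Finset.univ.filter (fun k => u k ≤ i)).card := by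
  rw [← card_filter_image_le hu, NCt]
  congr 1
  ext j
  simp only [Finset.mem_filter, Finset.mem_Icc, Finset.mem_image, Finset.mem_univ, true_and]
  constructor
  · rintro ⟨⟨h1, h2⟩, h3⟩
    exact ⟨hu_all j (Finset.mem_Icc.2 ⟨h1, h2.trans hi⟩) h3, h2⟩
  · rintro ⟨⟨k, rfl⟩, h⟩
    exact ⟨⟨(Finset.mem_Icc.1 (hu_mem k).1).1, h⟩, (hu_mem k).2⟩

/-- Comparing counting functions of two strictly increasing sequences at `b k` compares their
`k`-th terms. -/
theorem StrictMono.le_of_card_filter_le {r : ℕ} {a b : Fin r → ℕ} (ha : StrictMono a)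
    (hb : StrictMono b) {k : Fin r}
    (h : (Finset.univ.filter (fun j => b j ≤ b k)).card ≤
      (Finset.univ.filter (fun j => a j ≤ b k)).card) : a k ≤ b k := by
  by_contra! hlt
  have hsub : Finset.univ.filter (fun j => a j ≤ b k) ⊆ Finset.Iio k := by
    intro j hj
    exact Finset.mem_Iio.2 (ha.lt_iff_lt.1 ((Finset.mem_filter.1 hj).2.trans_lt hlt))
  have heq : Finset.univ.filter (fun j => b j ≤ b k) = Finset.Iic k := by
    ext j
    simp [hb.le_iff_le]
  have hcard := h.trans (Finset.card_le_card hsub)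
  rw [heq, Fin.card_Iic, Fin.card_Iio] at hcard
  omega

/-- Theorem of Bonin, de Mier and Noy: a set `B ⊆ {1,…,m+r}` with `|B| = r` is a
transversal of the set system `{[l_i, u_i] : i ∈ [r]}` (where `u` enumerates the
North-step positions of `P` and `l` those of `Q`) if and only if the lattice path
with North steps at the positions of `B` stays in the region bounded by `P` and `Q`. -/
theorem lpm_bases_are_bounded_paths (m r : ℕ) (P Q : ℕ → Bool)
    (hP : IsPath m r P) (hQ : IsPath m r Q) (hPQ : Below (m + r) P Q)
    (u l : Fin r → ℕ) (hu_mono : StrictMono u) (hl_mono : StrictMono l)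
    (hu_mem : ∀ k, u k ∈ Finset.Icc 1 (m + r) ∧ P (u k) = true)
    (hu_all : ∀ j ∈ Finset.Icc 1 (m + r), P j = true → ∃ k, u k = j)
    (hl_mem : ∀ k, l k ∈ Finset.Icc 1 (m + r) ∧ Q (l k) = true)
    (hl_all : ∀ j ∈ Finset.Icc 1 (m + r), Q j = true → ∃ k, l k = j)
    (B : Finset ℕ) (hB : B ⊆ Finset.Icc 1 (m + r)) (hBcard : B.card = r) :
    (∃ f : Fin r → ℕ, Function.Injective f ∧
        (∀ k, f k ∈ Finset.Icc (l k) (u k)) ∧ B = Finset.image f Finset.univ) ↔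
      (∀ i ≤ m + r, NCt P i ≤ (B.filter (fun j => j ≤ i)).card ∧
        (B.filter (fun j => j ≤ i)).card ≤ NCt Q i) := by
  have hP_card := fun i (hi : i ≤ m + r) =>
    NCt_eq_card_filter_le hu_mono.injective hu_mem hu_all hi
  have hQ_card := fun i (hi : i ≤ m + r) =>
    NCt_eq_card_filter_le hl_mono.injective hl_mem hl_all hi
  constructor
  · rintro ⟨f, hf, hmem, rfl⟩ i hi
    rw [card_filter_image_le hf, hP_card i hi, hQ_card i hi]
    constructor <;> refine Finset.card_le_card (Finset.monotone_filter_right _ fun k _ hk => ?_)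
    · exact (Finset.mem_Icc.1 (hmem k)).2.trans hk
    · exact (Finset.mem_Icc.1 (hmem k)).1.trans hk
  · intro h
    let f := B.orderEmbOfFin hBcard
    have himage : B = Finset.image f Finset.univ :=
      (Finset.image_orderEmbOfFin_univ B hBcard).symm
    have hcount : ∀ i, (B.filter (fun j => j ≤ i)).card =
        (Finset.univ.filter (fun k => f k ≤ i)).card := fun i => by
      rw [← card_filter_image_le f.injective, ← himage]
    refine ⟨f, f.injective, fun k => Finset.mem_Icc.2 ⟨?_, ?_⟩, himage⟩
    · have hk : f k ≤ m + r :=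
        (Finset.mem_Icc.1 (hB (Finset.orderEmbOfFin_mem B hBcard k))).2
      apply hl_mono.le_of_card_filter_le f.strictMono
      rw [← hcount, ← hQ_card _ hk]
      exact (h _ hk).2
    · have hk : u k ≤ m + r := (Finset.mem_Icc.1 (hu_mem k).1).2
      apply f.strictMono.le_of_card_filter_le hu_mono
      rw [← hcount, ← hP_card _ hk]
      exact (h _ hk).1
end

section
/- Let B be a nonempty collection of r-element subsets of {1,…,n} and let P(B) ⊆ ℝ^n be the convex hull of the indicator vectors {e_B : B ∈ B}. Then B is the collection of bases of a matroid on {1,…,n} if and only if every edge (one-dimensional face) of the polytope P(B) is parallel to a difference e_α − e_β of two distinct standard basis vectors of ℝ^n. -/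
/-- The 0/1 indicator vector in `ℝ^n` of a subset `B` of `Fin n`. -/
def ind' {n : ℕ} (B : Finset (Fin n)) : Fin n → ℝ := fun i => if i ∈ B then 1 else 0

section SymmetricExchange

theorem IsMatroidBases.symmetric_exchange {α : Type*} [DecidableEq α] [Finite α]
    {Bs : Set (Finset α)} (h : IsMatroidBases Bs) {B B' : Finset α} (hB : B ∈ Bs)
    (hB' : B' ∈ Bs) {x : α} (hx : x ∈ B \ B') :
    ∃ y ∈ B' \ B, insert y (B.erase x) ∈ Bs ∧ insert x (B'.erase y) ∈ Bs := by
  let M : Matroid α := Matroid.ofIsBaseOfFinite (E := Set.univ) Set.finite_univ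
    (fun S => ∃ A ∈ Bs, (A : Set α) = S) (h.1.elim fun A hA => ⟨A, A, hA, rfl⟩)
    (by
      rintro _ _ ⟨A, hA, rfl⟩ ⟨A', hA', rfl⟩ a ha
      have ha' : a ∈ A \ A' := by simpa using ha
      obtain ⟨b, hb, hbase⟩ := h.2 A hA A' hA'
        (by rintro rfl; simp at ha') a ha'
      exact ⟨b, by simpa using hb, _, hbase, by simp⟩)
    (fun _ _ => Set.subset_univ _)
  have hE : M.E = Set.univ := rfl
  have hM : ∀ A : Finset α, M.IsBase (A : Set α) ↔ A ∈ Bs := fun A =>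
    ⟨fun ⟨_, hA', h⟩ => Finset.coe_injective h ▸ hA', fun hA => ⟨A, hA, rfl⟩⟩
  obtain ⟨hxB, hxB'⟩ := Finset.mem_sdiff.1 hx
  have hb : M.IsBase (B : Set α) := (hM B).2 hB
  have hb' : M.IsBase (B' : Set α) := (hM B').2 hB'
  have hC := hb'.fundCircuit_isCircuit (x := x) (by simp [hE]) (by simpa using hxB')
  have hK := M.fundCocircuit_isCocircuit (e := x) (by simpa using hxB) hb
  obtain ⟨y, ⟨hyC, hyK⟩, hyx⟩ := (hC.isCocircuit_inter_nontrivial hK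
    ⟨x, M.mem_fundCircuit x _, M.mem_fundCocircuit x _⟩).exists_ne x
  have hyB' : y ∈ B' := by
    simpa [hyx] using M.fundCircuit_subset_insert x _ hyC
  have hyB : y ∉ B := by
    simpa [hyx] using M.fundCocircuit_subset_insert_compl x _ hyK |>.resolve_left hyx |>.2
  refine ⟨y, Finset.mem_sdiff.2 ⟨hyB', hyB⟩, ?_, ?_⟩
  · rw [hb.mem_fundCocircuit_iff_mem_fundCircuit, hb.indep.mem_fundCircuit_iff
      (by simp [hb.closure_eq, hE]) (by simpa using hyB)] at hyK
    have := hb.exchange_isBase_of_indep' (by simpa using hxB) (by simpa using hyB) hyK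
    rw [← hM]
    convert this using 1
    ext z
    simp only [Finset.coe_insert, Finset.coe_erase, Set.mem_insert_iff, Set.mem_sdiff,
      Finset.mem_coe, Set.mem_singleton_iff]
    grind
  · rw [hb'.indep.mem_fundCircuit_iff
      (by simp [hb'.closure_eq, hE]) (by simpa using hxB')] at hyC
    have := hb'.exchange_isBase_of_indep' (by simpa using hyB') (by simpa using hxB') hyC
    rw [← hM]
    convert this using 1
    ext z
    simp only [Finset.coe_insert, Finset.coe_erase, Set.mem_insert_iff, Set.mem_sdiff,
      Finset.mem_coe, Set.mem_singleton_iff]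
    grind

end SymmetricExchange

section Faces

variable {n : ℕ} {V F : Set (Fin n → ℝ)} {v : Fin n → ℝ}

theorem IsFace.isExtreme {S : Set (Fin n → ℝ)} (h : IsFace S F) : IsExtreme ℝ S F :=
  ⟨h.1, fun x hx y hy z hz hzo => (h.2.2 x hx y hy z hzo hz).1⟩

theorem isFace_self {S : Set (Fin n → ℝ)} (hS : Convex ℝ S) : IsFace S S :=
  ⟨subset_rfl, hS, fun _ hx _ hy _ _ _ => ⟨hx, hy⟩⟩

/-- A face of the convex hull of `V` is the convex hull of the points of `V` it contains. -/
theorem IsFace.subset_convexHull_inter (hF : IsFace (convexHull ℝ V) F) :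
    F ⊆ convexHull ℝ (V ∩ F) := by
  intro z hz
  have hdiff : convexHull ℝ (V \ F) ⊆ convexHull ℝ V \ F :=
    convexHull_min (Set.sdiff_subset_sdiff_left (subset_convexHull ℝ V))
      (hF.isExtreme.convex_sdiff (convex_convexHull ℝ V))
  have hzV := hF.1 hz
  rw [← Set.inter_union_sdiff V F] at hzV
  rcases (V \ F).eq_empty_or_nonempty with h2 | h2
  · simpa [h2] using hzV
  rcases (V ∩ F).eq_empty_or_nonempty with h1 | h1
  · rw [h1, Set.empty_union] at hzV
    exact ((hdiff hzV).2 hz).elim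
  rw [convexHull_union h1 h2, mem_convexJoin] at hzV
  obtain ⟨a, ha, b, hb, hab⟩ := hzV
  have hb' := hdiff hb
  rw [← insert_endpoints_openSegment] at hab
  rcases hab with rfl | rfl | hab
  · exact ha
  · exact (hb'.2 hz).elim
  · exact (hb'.2 (hF.2.2 a (convexHull_mono Set.inter_subset_left ha) b hb'.1 z hab hz).2).elim

/-- The points of a face at which a linear functional is maximal form a face. -/
theorem IsFace.inter_maximal {S : Set (Fin n → ℝ)} (hF : IsFace S F)
    (f : (Fin n → ℝ) →ₗ[ℝ] ℝ) (c : ℝ) (hc : ∀ z ∈ F, f z ≤ c) :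
    IsFace S {z ∈ F | f z = c} := by
  refine ⟨fun z hz => hF.1 hz.1, hF.2.1.inter (convex_hyperplane f.isLinear c), ?_⟩
  rintro x hx y hy z hzo ⟨hz, hzc⟩
  obtain ⟨hxF, hyF⟩ := hF.2.2 x hx y hy z hzo hz
  obtain ⟨a, b, ha, hb, hab, rfl⟩ := hzo
  have h1 := hc x hxF
  have h2 := hc y hyF
  simp only [map_add, map_smul, smul_eq_mul] at hzc
  obtain rfl : b = 1 - a := by linarith
  exact ⟨⟨hxF, by nlinarith⟩, ⟨hyF, by nlinarith⟩⟩

/-- Tilting the functional `η`, which is strictly maximal at the vertex `v`, by a multiple of `φ`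
until it supports a further vertex of the face `F`. -/
theorem IsFace.exists_tilted_subface (hV : V.Finite) (hF : IsFace (convexHull ℝ V) F)
    (hvF : v ∈ F) {η : (Fin n → ℝ) →ₗ[ℝ] ℝ} (hη : ∀ u ∈ V, u ≠ v → η u < η v)
    (φ : (Fin n → ℝ) →ₗ[ℝ] ℝ) (hu : ∃ u ∈ V ∩ F, u ≠ v) :
    ∃ (G : Set (Fin n → ℝ)) (m : ℝ), IsFace (convexHull ℝ V) G ∧ G ⊆ F ∧ v ∈ G ∧
      (∃ u ∈ V ∩ G, u ≠ v) ∧ (∀ z ∈ G, φ z - φ v = m * (η v - η z)) ∧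
      ∀ z ∈ V ∩ F, φ z - φ v ≤ m * (η v - η z) := by
  obtain ⟨u₀, hu₀, hu₀v⟩ := hu
  obtain ⟨u, ⟨huVF, huv⟩, hmax⟩ := Set.exists_max_image {u ∈ V ∩ F | u ≠ v}
    (fun u => (φ u - φ v) / (η v - η u)) (hV.subset fun u hu => hu.1.1) ⟨u₀, hu₀, hu₀v⟩
  set m := (φ u - φ v) / (η v - η u)
  have hle : ∀ z ∈ V ∩ F, φ z - φ v ≤ m * (η v - η z) := by
    intro z hz
    rcases eq_or_ne z v with rfl | hzv
    · simp
    · exact (div_le_iff₀ (sub_pos.2 (hη z hz.1 hzv))).1 (hmax z ⟨hz, hzv⟩)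
  have hle' : ∀ z ∈ F, (φ + m • η) z ≤ (φ + m • η) v := by
    intro z hz
    refine convexHull_min (fun w hw => ?_)
      (convex_halfSpace_le (φ + m • η).isLinear _) (hF.subset_convexHull_inter hz)
    have := hle w hw
    simp only [Set.mem_ofPred_eq, LinearMap.add_apply, LinearMap.smul_apply, smul_eq_mul]
    linarith
  refine ⟨_, m, hF.inter_maximal _ _ hle', fun z hz => hz.1, ⟨hvF, rfl⟩,
    ⟨u, ⟨huVF.1, huVF.2, ?_⟩, huv⟩, ?_, hle⟩
  · have : φ u - φ v = m * (η v - η u) :=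
      (div_mul_cancel₀ _ (sub_pos.2 (hη u huVF.1 huv)).ne').symm
    simp only [LinearMap.add_apply, LinearMap.smul_apply, smul_eq_mul]
    linarith
  · rintro z ⟨-, hz⟩
    simp only [LinearMap.add_apply, LinearMap.smul_apply, smul_eq_mul] at hz
    linarith

theorem fdim_eq_one_of_forall_vertex (hF : IsFace (convexHull ℝ V) F) (hvF : v ∈ F)
    {u : Fin n → ℝ} (huF : u ∈ F) (huv : u ≠ v)
    (h : ∀ w ∈ V ∩ F, w - v ∈ Submodule.span ℝ {u - v}) : fdim F = 1 := by
  have hspan : vectorSpan ℝ F = Submodule.span ℝ {u - v} := by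
    apply le_antisymm
    · rw [vectorSpan_eq_span_vsub_set_right ℝ hvF, Submodule.span_le]
      rintro _ ⟨z, hz, rfl⟩
      have hconv : Convex ℝ {z | z - v ∈ Submodule.span ℝ {u - v}} := by
        intro a ha b hb s t _ _ hst
        have : s • a + t • b - v = s • (a - v) + t • (b - v) := by
          obtain rfl : t = 1 - s := by linarith
          module
        simp only [Set.mem_ofPred_eq] at *
        rw [this]
        exact add_mem (Submodule.smul_mem _ _ ha) (Submodule.smul_mem _ _ hb)
      exact convexHull_min h hconv (hF.subset_convexHull_inter hz)
    · rw [Submodule.span_singleton_le_iff_mem]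
      exact vsub_mem_vectorSpan ℝ huF hvF
  rw [fdim, direction_affineSpan, hspan, finrank_span_singleton (sub_ne_zero.2 huv)]

/-- A face with a vertex `v` and a further vertex has an edge at `v`. -/
theorem IsFace.exists_edge (hV : V.Finite) {η : (Fin n → ℝ) →ₗ[ℝ] ℝ}
    (hη : ∀ u ∈ V, u ≠ v → η u < η v) (hF : IsFace (convexHull ℝ V) F)
    (hvF : v ∈ F) (hu : ∃ u ∈ V ∩ F, u ≠ v) :
    ∃ G, IsFace (convexHull ℝ V) G ∧ G ⊆ F ∧ v ∈ G ∧ (∃ u ∈ V ∩ G, u ≠ v) ∧ fdim G = 1 := by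
  induction hk : (V ∩ F).ncard using Nat.strong_induction_on generalizing F with
  | _ k ih =>
    subst hk
    obtain ⟨u, huVF, huv⟩ := hu
    by_cases hw : ∀ w ∈ V ∩ F, w - v ∈ Submodule.span ℝ {u - v}
    · exact ⟨F, hF, subset_rfl, hvF, ⟨u, huVF, huv⟩,
        fdim_eq_one_of_forall_vertex hF hvF huVF.2 huv hw⟩
    push Not at hw
    obtain ⟨w, hwVF, hw⟩ := hw
    have hupos : 0 < η v - η u := sub_pos.2 (hη u huVF.1 huv)
    have hd : (η v - η w) • (u - v) - (η v - η u) • (w - v) ≠ 0 := by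
      intro hd
      apply hw
      rw [Submodule.mem_span_singleton]
      refine ⟨(η v - η u)⁻¹ * (η v - η w), ?_⟩
      rw [mul_smul, sub_eq_zero.1 hd, inv_smul_smul₀ hupos.ne']
    obtain ⟨i, hi⟩ := Function.ne_iff.1 hd
    obtain ⟨G, m, hG, hGF, hvG, huG, heq, -⟩ :=
      hF.exists_tilted_subface hV hvF hη (LinearMap.proj i) ⟨u, huVF, huv⟩
    have hlt : (V ∩ G).ncard < (V ∩ F).ncard := by
      refine Set.ncard_lt_ncard ⟨Set.inter_subset_inter_right V hGF, fun hsub => hi ?_⟩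
        (hV.subset Set.inter_subset_left)
      have h1 := heq u (hsub huVF).2
      have h2 := heq w (hsub hwVF).2
      simp only [LinearMap.proj_apply] at h1 h2
      simp only [Pi.sub_apply, Pi.smul_apply, smul_eq_mul, Pi.zero_apply, h1, h2]
      ring
    obtain ⟨E, hE, hEG, h⟩ := ih _ hlt hG hvG huG rfl
    exact ⟨E, hE, hEG.trans hGF, h⟩

/-- If the vertex `v` does not maximize `φ`, then `φ` increases along some edge at `v`. -/
theorem exists_edge_increasing (hV : V.Finite) (hv : v ∈ V) {η : (Fin n → ℝ) →ₗ[ℝ] ℝ}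
    (hη : ∀ u ∈ V, u ≠ v → η u < η v) (φ : (Fin n → ℝ) →ₗ[ℝ] ℝ)
    {w : Fin n → ℝ} (hw : w ∈ V) (hφ : φ v < φ w) :
    ∃ F, IsFace (convexHull ℝ V) F ∧ fdim F = 1 ∧ v ∈ F ∧ ∃ u ∈ V ∩ F, φ v < φ u := by
  have hsub := subset_convexHull ℝ V
  have hwv : w ≠ v := by rintro rfl; exact hφ.false
  obtain ⟨G, m, hG, -, hvG, huG, heq, hle⟩ :=
    (isFace_self (convex_convexHull ℝ V)).exists_tilted_subface hV (hsub hv) hη φ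
      ⟨w, ⟨hw, hsub hw⟩, hwv⟩
  have hm : 0 < m := by
    have h1 := hle w ⟨hw, hsub hw⟩
    exact pos_of_mul_pos_left (lt_of_lt_of_le (sub_pos.2 hφ) h1) (sub_pos.2 (hη w hw hwv)).le
  obtain ⟨E, hE, hEG, hvE, ⟨u, hu, huv⟩, hdim⟩ := hG.exists_edge hV hη hvG huG
  refine ⟨E, hE, hdim, hvE, u, hu, ?_⟩
  rw [← sub_pos, heq u (hEG hu.2)]
  exact mul_pos hm (sub_pos.2 (hη u hu.1 huv))

end Faces

section Indicator

variable {n : ℕ}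

theorem ind'_injective : Function.Injective (ind' : Finset (Fin n) → Fin n → ℝ) := by
  intro A B h
  ext i
  have := congrFun h i
  by_cases h1 : i ∈ A <;> by_cases h2 : i ∈ B <;> simp_all [ind']

theorem sum_ind' (S U : Finset (Fin n)) : ∑ i ∈ S, ind' U i = ((S ∩ U).card : ℝ) := by
  simp [ind']

/-- If two indicator vectors differ by a multiple of `e_α - e_β`, then the sets differ by
exchanging a single element. -/
theorem exists_insert_erase_of_ind'_sub {B U : Finset (Fin n)} (hne : U ≠ B) {α β : Fin n}
    (hαβ : α ≠ β) {c : ℝ}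
    (h : ind' U - ind' B = c • (Pi.single α (1 : ℝ) - Pi.single β (1 : ℝ))) :
    ∃ a b, a ∈ U \ B ∧ b ∈ B \ U ∧ U = insert a (B.erase b) := by
  have hcoord : ∀ i, i ≠ α → i ≠ β → (i ∈ U ↔ i ∈ B) := by
    intro i h1 h2
    have := congrFun h i
    by_cases hU : i ∈ U <;> by_cases hB : i ∈ B <;> simp_all [ind']
  have hα : ind' U α - ind' B α = c := by simpa [hαβ] using congrFun h α
  have hβ : ind' U β - ind' B β = -c := by simpa [hαβ.symm] using congrFun h β
  have hc : c ≠ 0 := by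
    rintro rfl
    exact hne (ind'_injective (sub_eq_zero.1 (by simpa using h)))
  have hcases : (α ∈ U ∧ α ∉ B ∧ β ∈ B ∧ β ∉ U) ∨ (β ∈ U ∧ β ∉ B ∧ α ∈ B ∧ α ∉ U) := by
    subst hα
    by_cases h1 : α ∈ U <;> by_cases h2 : α ∈ B <;> by_cases h3 : β ∈ U <;>
      by_cases h4 : β ∈ B <;> simp [ind', h1, h2, h3, h4] at hc hβ ⊢ <;> norm_num at hβ
  rcases hcases with ⟨h1, h2, h3, h4⟩ | ⟨h1, h2, h3, h4⟩
  · refine ⟨α, β, by simp [h1, h2], by simp [h3, h4], ?_⟩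
    ext i
    grind
  · refine ⟨β, α, by simp [h1, h2], by simp [h3, h4], ?_⟩
    ext i
    grind

end Indicator

theorem IsMatroidBases.edge_parallel {n : ℕ} {Bs : Set (Finset (Fin n))} {r : ℕ}
    (hr : ∀ B ∈ Bs, B.card = r) (h : IsMatroidBases Bs) {F : Set (Fin n → ℝ)}
    (hF : IsFace (convexHull ℝ (ind' '' Bs)) F) (hdim : fdim F = 1) :
    ∃ α β : Fin n, α ≠ β ∧ ∀ x ∈ F, ∀ y ∈ F,
      ∃ c : ℝ, x - y = c • (Pi.single α (1 : ℝ) - Pi.single β (1 : ℝ)) := by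
  have hVF : ¬ (ind' '' Bs ∩ F).Subsingleton := by
    intro hs
    have hFs : F.Subsingleton := by
      refine Set.Subsingleton.anti ?_ hF.subset_convexHull_inter
      rcases hs.eq_empty_or_singleton with h0 | ⟨p, hp⟩ <;> simp [*]
    rw [fdim, direction_affineSpan, vectorSpan_of_subsingleton ℝ hFs, finrank_bot] at hdim
    exact zero_ne_one hdim
  rw [Set.not_subsingleton_iff] at hVF
  obtain ⟨_, ⟨⟨B, hB, rfl⟩, hBF⟩, _, ⟨⟨B', hB', rfl⟩, hBF'⟩, hne⟩ := hVF
  have hx : (B \ B').Nonempty := by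
    rw [Finset.sdiff_nonempty]
    intro hsub
    exact hne (congrArg ind' (Finset.eq_of_subset_of_card_le hsub (by rw [hr _ hB, hr _ hB'])))
  obtain ⟨x, hx⟩ := hx
  obtain ⟨y, hy, h1, h2⟩ := h.symmetric_exchange hB hB' hx
  rw [Finset.mem_sdiff] at hx hy
  have hxy : x ≠ y := by rintro rfl; exact hy.2 hx.1
  have hsub := subset_convexHull ℝ (ind' '' Bs)
  have hdiff : ind' B - ind' (insert y (B.erase x)) =
      (Pi.single x (1 : ℝ) - Pi.single y (1 : ℝ) : Fin n → ℝ) := by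
    ext i
    simp only [ind', Pi.sub_apply, Pi.single_apply, Finset.mem_insert, Finset.mem_erase]
    grind
  have hdiff' : ind' B' - ind' (insert x (B'.erase y)) =
      (Pi.single y (1 : ℝ) - Pi.single x (1 : ℝ) : Fin n → ℝ) := by
    ext i
    simp only [ind', Pi.sub_apply, Pi.single_apply, Finset.mem_insert, Finset.mem_erase]
    grind
  have hmid : (1 / 2 : ℝ) • ind' (insert y (B.erase x)) + (1 / 2 : ℝ) • ind' (insert x (B'.erase y))
      = (1 / 2 : ℝ) • ind' B + (1 / 2 : ℝ) • ind' B' := by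
    rw [← smul_add, ← smul_add]
    congr 1
    rw [sub_eq_iff_eq_add] at hdiff hdiff'
    rw [hdiff, hdiff']
    abel
  have hmF : (1 / 2 : ℝ) • ind' B + (1 / 2 : ℝ) • ind' B' ∈ F :=
    hF.2.1 hBF hBF' (by norm_num) (by norm_num) (by norm_num)
  have hNF := (hF.2.2 _ (hsub ⟨_, h1, rfl⟩) _ (hsub ⟨_, h2, rfl⟩) _
    ⟨1 / 2, 1 / 2, by norm_num, by norm_num, by norm_num, hmid⟩ hmF).1
  have hmem : (Pi.single x (1 : ℝ) - Pi.single y (1 : ℝ) : Fin n → ℝ) ∈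
      (affineSpan ℝ F).direction := by
    rw [direction_affineSpan, ← hdiff]
    exact vsub_mem_vectorSpan ℝ hBF hNF
  have hnz : (Pi.single x (1 : ℝ) - Pi.single y (1 : ℝ) : Fin n → ℝ) ≠ 0 := by
    intro h0
    simpa [hxy] using congrFun h0 x
  refine ⟨x, y, hxy, fun p hp q hq => ?_⟩
  obtain ⟨c, hc⟩ := (finrank_eq_one_iff_of_nonzero'
    (⟨_, hmem⟩ : (affineSpan ℝ F).direction) (by simpa [Subtype.ext_iff] using hnz)).1 hdim
    ⟨p - q, by rw [direction_affineSpan]; exact vsub_mem_vectorSpan ℝ hp hq⟩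
  exact ⟨c, (congrArg Subtype.val hc).symm⟩

theorem exists_exchange_of_edges_parallel {n r : ℕ} {Bs : Set (Finset (Fin n))}
    (hr : ∀ B ∈ Bs, B.card = r)
    (h : ∀ F : Set (Fin n → ℝ), IsFace (convexHull ℝ (ind' '' Bs)) F → fdim F = 1 →
      ∃ α β : Fin n, α ≠ β ∧ ∀ x ∈ F, ∀ y ∈ F,
        ∃ c : ℝ, x - y = c • (Pi.single α (1 : ℝ) - Pi.single β (1 : ℝ)))
    {B B' : Finset (Fin n)} (hB : B ∈ Bs) (hB' : B' ∈ Bs) {x : Fin n} (hx : x ∈ B \ B') :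
    ∃ y ∈ B' \ B, insert y (B.erase x) ∈ Bs := by
  obtain ⟨hxB, hxB'⟩ := Finset.mem_sdiff.1 hx
  let ℓ : Finset (Fin n) → (Fin n → ℝ) →ₗ[ℝ] ℝ := fun S => ∑ i ∈ S, LinearMap.proj i
  have hℓ : ∀ S U, ℓ S (ind' U) = ((S ∩ U).card : ℝ) := by
    intro S U
    simp [ℓ, ← sum_ind']
  have hη : ∀ u ∈ ind' '' Bs, u ≠ ind' B → ℓ B u < ℓ B (ind' B) := by
    rintro _ ⟨U, hU, rfl⟩ hne
    rw [hℓ, hℓ, Nat.cast_lt, Finset.inter_self]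
    refine Finset.card_lt_card ⟨Finset.inter_subset_left, fun hsub => hne ?_⟩
    rw [Finset.eq_of_subset_of_card_le (fun i hi => (Finset.mem_inter.1 (hsub hi)).2)
      (by rw [hr _ hB, hr _ hU])]
  let T : Finset (Fin n) := insert x (B ∪ B')ᶜ
  have hTB : T ∩ B = {x} := by
    ext i
    simp only [T, Finset.mem_inter, Finset.mem_insert, Finset.mem_compl, Finset.mem_union,
      Finset.mem_singleton]
    grind
  have hTB' : T ∩ B' = ∅ := by
    ext i
    simp only [T, Finset.mem_inter, Finset.mem_insert, Finset.mem_compl, Finset.mem_union,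
      Finset.notMem_empty]
    grind
  obtain ⟨F, hF, hdim, hBF, _, ⟨⟨U, hU, rfl⟩, hUF⟩, hlt⟩ :=
    exists_edge_increasing (Bs.toFinite.image ind') ⟨B, hB, rfl⟩ hη (-ℓ T) ⟨B', hB', rfl⟩
      (by simp [hℓ, hTB, hTB'])
  have hTU : T ∩ U = ∅ := by
    simpa [hℓ, hTB] using hlt
  obtain ⟨α, β, hαβ, hpar⟩ := h F hF hdim
  obtain ⟨c, hc⟩ := hpar _ hUF _ hBF
  have hUB : U ≠ B := by
    rintro rfl
    simp [hTB] at hTU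
  obtain ⟨a, b, ha, hb, hUab⟩ := exists_insert_erase_of_ind'_sub hUB hαβ hc
  have hT : ∀ i ∈ U, i ≠ x ∧ (i ∈ B ∨ i ∈ B') := by
    intro i hi
    have : i ∉ T := fun hiT => Finset.notMem_empty i (hTU ▸ Finset.mem_inter.2 ⟨hiT, hi⟩)
    simp only [T, Finset.mem_insert, Finset.mem_compl, Finset.mem_union] at this
    tauto
  rw [Finset.mem_sdiff] at ha hb
  have hbx : x = b := by
    by_contra hne
    have : x ∈ U := by rw [hUab]; simp [hne, hxB]
    exact (hT x this).1 rfl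
  subst hbx
  exact ⟨a, Finset.mem_sdiff.2 ⟨((hT a ha.1).2).resolve_left ha.2, ha.2⟩, hUab ▸ hU⟩

/-- Gelfand–Goresky–MacPherson–Serganova: a nonempty collection `Bs` of `r`-element
subsets of `{1,…,n}` is the collection of bases of a matroid if and only if every
edge of the polytope `conv{e_B : B ∈ Bs}` is parallel to a difference `e_α - e_β`
of two distinct standard basis vectors. -/
theorem matroid_iff_edges_parallel (n r : ℕ) (Bs : Set (Finset (Fin n)))
    (hne : Bs.Nonempty) (hr : ∀ B ∈ Bs, B.card = r) :
    IsMatroidBases Bs ↔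
      ∀ F : Set (Fin n → ℝ), IsFace (convexHull ℝ (ind' '' Bs)) F → fdim F = 1 →
        ∃ α β : Fin n, α ≠ β ∧ ∀ x ∈ F, ∀ y ∈ F,
          ∃ c : ℝ, x - y = c • (Pi.single α (1 : ℝ) - Pi.single β (1 : ℝ)) := by
  exact ⟨fun h F hF hdim => h.edge_parallel hr hF hdim, fun h => ⟨hne, fun B hB B' hB' _ x hx =>
    exists_exchange_of_edges_parallel hr h hB hB' hx⟩⟩
end

section
/- Let M be a matroid on {1,…,n}. Define α ∼ β for α, β ∈ {1,…,n} if there exist bases B, B' of M with α ∈ B and B' = (B \ {α}) ∪ {β}, and let c(M) be the number of equivalence classes of the equivalence relation generated by ∼ (the connected components of M). Then the dimension of the affine hull of the matroid base polytope P(M) equals n − c(M). -/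
/-- The basis-exchange relation on the ground set: `a ∼ b` iff there are bases
`B`, `B'` with `a ∈ B` and `B' = (B \ {a}) ∪ {b}`. -/
def ExchRel {n : ℕ} (Bs : Set (Finset (Fin n))) (a b : Fin n) : Prop :=
  ∃ B ∈ Bs, ∃ B' ∈ Bs, a ∈ B ∧ B' = insert b (B.erase a)

theorem IsMatroidBases.eq_of_subset {α : Type*} [DecidableEq α] {Bs : Set (Finset α)}
    (hM : IsMatroidBases Bs) {B B' : Finset α} (hB : B ∈ Bs) (hB' : B' ∈ Bs) (h : B ⊆ B') :
    B = B' := by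
  by_contra hne
  obtain ⟨x, hx⟩ : (B' \ B).Nonempty :=
    Finset.sdiff_nonempty.2 fun h' => hne (h.antisymm h')
  obtain ⟨y, hy, -⟩ := hM.2 B' hB' B hB (Ne.symm hne) x hx
  rw [Finset.mem_sdiff] at hy
  exact hy.2 (h hy.1)

theorem ind'_sub_ind'_insert_erase {n : ℕ} {B : Finset (Fin n)} {a b : Fin n} (ha : a ∈ B)
    (hb : b ∉ B.erase a) :
    ind' B - ind' (insert b (B.erase a)) = Pi.single a (1 : ℝ) - Pi.single b 1 := by
  funext i
  by_cases hia : i = a <;> by_cases hib : i = b <;> by_cases hi : i ∈ B <;>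
    simp_all [ind']

/-- The span of the differences `e_a - e_b` over all related pairs `(a, b)`. -/
def relDiffSpan {ι : Type*} [DecidableEq ι] (r : ι → ι → Prop) : Submodule ℝ (ι → ℝ) :=
  Submodule.span ℝ {v | ∃ a b, r a b ∧ v = Pi.single a (1 : ℝ) - Pi.single b 1}

theorem finrank_relDiffSpan {ι : Type*} [Fintype ι] [DecidableEq ι] (r : ι → ι → Prop) :
    Module.finrank ℝ (relDiffSpan r) = Fintype.card ι - Nat.card (Quot r) := by
  classical
  have : Fintype (Quot r) := Fintype.ofFinite _
  let φ : (ι → ℝ) →ₗ[ℝ] (Quot r → ℝ) :=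
    Fintype.linearCombination ℝ fun i => Pi.single (Quot.mk r i) (1 : ℝ)
  have hφ (i : ι) : φ (Pi.single i 1) = Pi.single (Quot.mk r i) 1 := by
    simp [φ, Fintype.linearCombination_apply_single]
  have hsurj : LinearMap.range φ = ⊤ := by
    rw [eq_top_iff, ← (Pi.basisFun ℝ (Quot r)).span_eq, Submodule.span_le]
    rintro _ ⟨q, rfl⟩
    obtain ⟨i, rfl⟩ := Quot.exists_rep q
    exact ⟨Pi.single i 1, by rw [hφ, Pi.basisFun_apply]⟩
  have hker : LinearMap.ker φ = relDiffSpan r := by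
    apply le_antisymm
    · have hmk : ∀ a b, r a b → (relDiffSpan r).mkQ (Pi.single a (1 : ℝ)) =
          (relDiffSpan r).mkQ (Pi.single b 1) := fun a b hab => by
        rw [← sub_eq_zero, ← map_sub, Submodule.mkQ_apply, Submodule.Quotient.mk_eq_zero]
        exact Submodule.subset_span ⟨a, b, hab, rfl⟩
      have hfac : (relDiffSpan r).mkQ =
          (Fintype.linearCombination ℝ (Quot.lift _ hmk)).comp φ := by
        refine (Pi.basisFun ℝ ι).ext fun i => ?_
        rw [LinearMap.comp_apply, Pi.basisFun_apply, hφ,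
          Fintype.linearCombination_apply_single, one_smul]
      calc LinearMap.ker φ ≤ LinearMap.ker (relDiffSpan r).mkQ := by
            rw [hfac]; exact LinearMap.ker_le_ker_comp _ _
        _ = relDiffSpan r := Submodule.ker_mkQ _
    · refine Submodule.span_le.2 ?_
      rintro _ ⟨a, b, hab, rfl⟩
      rw [SetLike.mem_coe, LinearMap.mem_ker, map_sub, hφ, hφ, Quot.sound hab, sub_self]
  have hdim := φ.finrank_range_add_finrank_ker
  rw [hsurj, finrank_top, Module.finrank_fintype_fun_eq_card, Module.finrank_fintype_fun_eq_card,
    hker] at hdim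
  rw [Nat.card_eq_fintype_card]
  omega

theorem IsMatroidBases.ind'_sub_ind'_mem {n : ℕ} {Bs : Set (Finset (Fin n))}
    (hM : IsMatroidBases Bs) {B B' : Finset (Fin n)} (hB : B ∈ Bs) (hB' : B' ∈ Bs) :
    ind' B - ind' B' ∈ relDiffSpan (ExchRel Bs) := by
  induction h : (B \ B').card using Nat.strong_induction_on generalizing B with
  | _ k ih =>
    by_cases hne : B = B'
    · simp [hne]
    obtain ⟨x, hx⟩ : (B \ B').Nonempty :=
      Finset.sdiff_nonempty.2 fun h' => hne (hM.eq_of_subset hB hB' h')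
    obtain ⟨y, hy, hB₁⟩ := hM.2 B hB B' hB' hne x hx
    have hx' := Finset.mem_sdiff.1 hx
    have hy' := Finset.mem_sdiff.1 hy
    have hlt : (insert y (B.erase x) \ B').card < k := by
      rw [← h]
      apply Finset.card_lt_card
      rw [Finset.insert_sdiff_of_mem _ hy'.1, Finset.erase_sdiff_comm]
      exact Finset.erase_ssubset hx
    rw [← sub_add_sub_cancel _ (ind' (insert y (B.erase x))),
      ind'_sub_ind'_insert_erase hx'.1 fun h' => hy'.2 (Finset.mem_of_mem_erase h')]
    exact add_mem (Submodule.subset_span ⟨x, y, ⟨B, hB, _, hB₁, hx'.1, rfl⟩, rfl⟩)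
      (ih _ hlt hB₁ rfl)

theorem IsMatroidBases.vectorSpan_eq {n : ℕ} {Bs : Set (Finset (Fin n))}
    (hM : IsMatroidBases Bs) :
    vectorSpan ℝ (ind' '' Bs) = relDiffSpan (ExchRel Bs) := by
  apply le_antisymm
  · refine Submodule.span_le.2 ?_
    rintro _ ⟨_, ⟨B, hB, rfl⟩, _, ⟨B', hB', rfl⟩, rfl⟩
    exact hM.ind'_sub_ind'_mem hB hB'
  · refine Submodule.span_le.2 ?_
    rintro _ ⟨a, b, ⟨B, hB, _, hB', ha, rfl⟩, rfl⟩
    have hb : b ∉ B.erase a := fun hb => by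
      rw [Finset.insert_eq_of_mem hb] at hB'
      exact Finset.erase_ne_self.2 ha (hM.eq_of_subset hB' hB (Finset.erase_subset _ _))
    rw [← ind'_sub_ind'_insert_erase ha hb]
    exact vsub_mem_vectorSpan ℝ (Set.mem_image_of_mem _ hB) (Set.mem_image_of_mem _ hB')

/-- Feichtner–Sturmfels: the dimension of the matroid base polytope equals
`n - c(M)`, where `c(M)` is the number of connected components of `M`, i.e. the
number of equivalence classes of the equivalence relation generated by the
basis-exchange relation. -/
theorem matroid_polytope_dim (n : ℕ) (Bs : Set (Finset (Fin n)))
    (hM : IsMatroidBases Bs) :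
    fdim (convexHull ℝ (ind' '' Bs)) = n - Nat.card (Quot (ExchRel Bs)) := by
  rw [fdim, affineSpan_convexHull, direction_affineSpan, hM.vectorSpan_eq, finrank_relDiffSpan,
    Fintype.card_fin]
end

section
/- Let P and Q be lattice paths from (0,0) to (m,r) with P never going above Q, and let k = |{i ∈ {0,1,…,m+r} : N(P,i) = N(Q,i)}| be the number of intersection points of P and Q. Then the dimension of the affine hull of the lattice path matroid polytope P(M[P,Q]) equals m + r − k + 1. -/
lemma NCt_zero (P : ℕ → Bool) : NCt P 0 = 0 := by simp [NCt]

lemma NCt_succ (P : ℕ → Bool) (i : ℕ) :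
    NCt P (i + 1) = NCt P i + if P (i + 1) = true then 1 else 0 := by
  unfold NCt
  rw [← Finset.insert_Icc_right_eq_Icc_add_one (by omega), Finset.filter_insert]
  split_ifs <;> simp

lemma NCt_step (P : ℕ → Bool) (i : ℕ) :
    NCt P i ≤ NCt P (i + 1) ∧ NCt P (i + 1) ≤ NCt P i + 1 := by
  rw [NCt_succ]
  split_ifs <;> omega

/-- The set of positions in `{1, …, n}` at which the height function `h` increases. -/
def riseSet (n : ℕ) (h : ℕ → ℕ) : Finset ℕ :=
  (Finset.Icc 1 n).filter (fun j => h j = h (j - 1) + 1)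

lemma card_riseSet_filter_le (n : ℕ) (h : ℕ → ℕ) (h0 : h 0 = 0)
    (hs : ∀ i, h i ≤ h (i + 1) ∧ h (i + 1) ≤ h i + 1) (i : ℕ) (hi : i ≤ n) :
    ((riseSet n h).filter (fun j => j ≤ i)).card = h i := by
  induction i with
  | zero =>
    rw [h0, Finset.card_eq_zero, Finset.filter_eq_empty_iff]
    intro j hj
    simp only [riseSet, Finset.mem_filter, Finset.mem_Icc] at hj
    omega
  | succ i ih =>
    have ih := ih (by omega)
    by_cases hr : h (i + 1) = h i + 1
    · have : (riseSet n h).filter (fun j => j ≤ i + 1) =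
          insert (i + 1) ((riseSet n h).filter (fun j => j ≤ i)) := by
        ext j
        simp only [riseSet, Finset.mem_filter, Finset.mem_Icc, Finset.mem_insert]
        by_cases hj : j = i + 1
        · subst hj
          simp [hr]
          omega
        · have : j ≤ i + 1 ↔ j ≤ i := by omega
          simp [hj, this]
      rw [this, Finset.card_insert_of_notMem (by simp), ih, hr]
    · have : (riseSet n h).filter (fun j => j ≤ i + 1) =
          (riseSet n h).filter (fun j => j ≤ i) := by
        ext j
        simp only [riseSet, Finset.mem_filter, Finset.mem_Icc]
        by_cases hj : j = i + 1
        · subst hj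
          simp [hr]
        · have : j ≤ i + 1 ↔ j ≤ i := by omega
          simp [this]
      rw [this, ih]
      have := hs i
      omega

/-- The height function `g` clamped between the heights of `P` and `Q`. -/
def clampHeight (P Q : ℕ → Bool) (g : ℕ → ℕ) (j : ℕ) : ℕ :=
  max (NCt P j) (min (NCt Q j) (g j))

lemma card_riseSet_clampHeight (n : ℕ) (P Q : ℕ → Bool) (g : ℕ → ℕ)
    (hg : ∀ i, g i ≤ g (i + 1) ∧ g (i + 1) ≤ g i + 1) (i : ℕ) (hi : i ≤ n) :
    ((riseSet n (clampHeight P Q g)).filter (fun j => j ≤ i)).card = clampHeight P Q g i := by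
  refine card_riseSet_filter_le n _ (by simp [clampHeight, NCt_zero]) (fun j => ?_) i hi
  have := NCt_step P j
  have := NCt_step Q j
  have := hg j
  simp only [clampHeight]
  omega

lemma isLPBasis_riseSet_clampHeight {m r : ℕ} {P Q : ℕ → Bool}
    (hP : IsPath m r P) (hQ : IsPath m r Q) (hPQ : Below (m + r) P Q) (g : ℕ → ℕ)
    (hg : ∀ i, g i ≤ g (i + 1) ∧ g (i + 1) ≤ g i + 1) :
    IsLPBasis m r P Q (riseSet (m + r) (clampHeight P Q g)) := by
  have hsub : riseSet (m + r) (clampHeight P Q g) ⊆ Finset.Icc 1 (m + r) :=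
    Finset.filter_subset _ _
  refine ⟨hsub, ?_, fun i hi => ?_⟩
  · have h := card_riseSet_clampHeight (m + r) P Q g hg (m + r) le_rfl
    rw [Finset.filter_true_of_mem fun j hj => (Finset.mem_Icc.1 (hsub hj)).2] at h
    rw [h, clampHeight, hP, hQ]
    omega
  · rw [card_riseSet_clampHeight (m + r) P Q g hg i hi, clampHeight]
    have := hPQ i hi
    omega

/-- The sum of the first `i` coordinates of a vector, as a linear functional. -/
noncomputable def prefixSum (n i : ℕ) : (Fin n → ℝ) →ₗ[ℝ] ℝ :=
  ∑ j ∈ Finset.univ.filter (fun j : Fin n => (j : ℕ) < i), LinearMap.proj j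

lemma prefixSum_apply (n i : ℕ) (x : Fin n → ℝ) :
    prefixSum n i x = ∑ j ∈ Finset.univ.filter (fun j : Fin n => (j : ℕ) < i), x j := by
  simp [prefixSum]

lemma prefixSum_succ (n : ℕ) (x : Fin n → ℝ) (j : Fin n) :
    prefixSum n (j + 1) x = prefixSum n j x + x j := by
  have : Finset.univ.filter (fun l : Fin n => (l : ℕ) < j + 1) =
      insert j (Finset.univ.filter (fun l : Fin n => (l : ℕ) < j)) := by
    ext l
    simp only [Finset.mem_filter, Finset.mem_univ, true_and, Finset.mem_insert, Fin.ext_iff]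
    omega
  rw [prefixSum_apply, prefixSum_apply, this, Finset.sum_insert (by simp), add_comm]

lemma eq_zero_of_prefixSum_eq_zero {n : ℕ} {x : Fin n → ℝ}
    (h : ∀ i ≤ n, prefixSum n i x = 0) : x = 0 := by
  ext j
  have h1 := prefixSum_succ n x j
  rw [h _ j.isLt, h _ j.isLt.le, zero_add] at h1
  exact h1.symm

lemma prefixSum_ind {n : ℕ} (i : ℕ) {B : Finset ℕ} (hB : B ⊆ Finset.Icc 1 n) :
    prefixSum n i (ind n B) = ((B.filter (fun j => j ≤ i)).card : ℝ) := by
  simp only [prefixSum_apply, ind, Finset.sum_boole, Finset.filter_filter, Nat.cast_inj]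
  refine Finset.card_bij (fun j _ => (j : ℕ) + 1) ?_ ?_ ?_
  · intro j hj
    simp only [Finset.mem_filter, Finset.mem_univ, true_and] at hj ⊢
    exact ⟨hj.2, hj.1⟩
  · intro a _ b _ hab
    exact Fin.ext (by omega)
  · intro b hb
    rw [Finset.mem_filter] at hb
    have hb1 := Finset.mem_Icc.1 (hB hb.1)
    have hb2 : b - 1 + 1 = b := by omega
    refine ⟨⟨b - 1, by omega⟩, ?_, hb2⟩
    simp only [Finset.mem_filter, Finset.mem_univ, true_and, hb2]
    exact ⟨by omega, hb.1⟩

lemma direction_affineSpan_LPMPoly (m r : ℕ) (P Q : ℕ → Bool) :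
    (affineSpan ℝ (LPMPoly m r P Q)).direction =
      vectorSpan ℝ (ind (m + r) '' {B | IsLPBasis m r P Q B}) := by
  rw [LPMPoly, affineSpan_convexHull, direction_affineSpan]

lemma prefixSum_eq_zero_of_mem_vectorSpan {m r : ℕ} {P Q : ℕ → Bool} {i : ℕ}
    (hi : i ≤ m + r) (hPQi : NCt P i = NCt Q i) {x : Fin (m + r) → ℝ}
    (hx : x ∈ vectorSpan ℝ (ind (m + r) '' {B | IsLPBasis m r P Q B})) :
    prefixSum (m + r) i x = 0 := by
  suffices h : vectorSpan ℝ (ind (m + r) '' {B | IsLPBasis m r P Q B}) ≤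
      LinearMap.ker (prefixSum (m + r) i) from h hx
  rw [vectorSpan_def, Submodule.span_le]
  rintro _ ⟨_, ⟨B, hB, rfl⟩, _, ⟨C, hC, rfl⟩, rfl⟩
  have hB' := hB.2.2 i hi
  have hC' := hC.2.2 i hi
  simp only [vsub_eq_sub, SetLike.mem_coe, LinearMap.mem_ker, map_sub, prefixSum_ind i hB.1,
    prefixSum_ind i hC.1, sub_eq_zero, Nat.cast_inj]
  omega

lemma exists_mem_vectorSpan_prefixSum_eq_single {m r : ℕ} {P Q : ℕ → Bool}
    (hP : IsPath m r P) (hQ : IsPath m r Q) (hPQ : Below (m + r) P Q) {i : ℕ}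
    (hne : NCt P i ≠ NCt Q i) :
    ∃ x ∈ vectorSpan ℝ (ind (m + r) '' {B | IsLPBasis m r P Q B}),
      ∀ j ≤ m + r, prefixSum (m + r) j x = if j = i then 1 else 0 := by
  set g₁ : ℕ → ℕ := fun j => if j < i then NCt P i else NCt P i + 1 with hg₁
  set g₂ : ℕ → ℕ := fun j => if j ≤ i then NCt P i else NCt P i + 1 with hg₂
  have hs₁ : ∀ j, g₁ j ≤ g₁ (j + 1) ∧ g₁ (j + 1) ≤ g₁ j + 1 := by
    intro j
    simp only [hg₁]
    split_ifs <;> omega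
  have hs₂ : ∀ j, g₂ j ≤ g₂ (j + 1) ∧ g₂ (j + 1) ≤ g₂ j + 1 := by
    intro j
    simp only [hg₂]
    split_ifs <;> omega
  have hB₁ := isLPBasis_riseSet_clampHeight hP hQ hPQ g₁ hs₁
  have hB₂ := isLPBasis_riseSet_clampHeight hP hQ hPQ g₂ hs₂
  refine ⟨_, vsub_mem_vectorSpan ℝ (Set.mem_image_of_mem _ hB₁) (Set.mem_image_of_mem _ hB₂),
    fun j hj => ?_⟩
  rw [vsub_eq_sub, map_sub, prefixSum_ind j hB₁.1, prefixSum_ind j hB₂.1,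
    card_riseSet_clampHeight _ P Q g₁ hs₁ j hj, card_riseSet_clampHeight _ P Q g₂ hs₂ j hj]
  split_ifs with hji
  · subst hji
    have hle := hPQ j hj
    have h₁ : clampHeight P Q g₁ j = NCt P j + 1 := by
      simp only [clampHeight, hg₁, lt_irrefl, if_false]
      omega
    have h₂ : clampHeight P Q g₂ j = NCt P j := by
      simp only [clampHeight, hg₂, le_refl, if_true]
      omega
    rw [h₁, h₂]
    push_cast
    ring
  · have hg : g₁ j = g₂ j := by
      simp only [hg₁, hg₂, le_iff_lt_or_eq, hji, or_false]
    rw [clampHeight, clampHeight, hg, sub_self]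

/-- The dimension of the lattice path matroid polytope is `m + r - k + 1`, where
`k` is the number of intersection points of `P` and `Q`. -/
theorem lpm_polytope_dim (m r : ℕ) (P Q : ℕ → Bool)
    (hP : IsPath m r P) (hQ : IsPath m r Q) (hPQ : Below (m + r) P Q) :
    fdim (LPMPoly m r P Q) =
      m + r + 1 - ((Finset.range (m + r + 1)).filter (fun i => NCt P i = NCt Q i)).card := by
  set A := (Finset.range (m + r + 1)).filter (fun i => ¬ NCt P i = NCt Q i) with hA
  have hcard : A.card =
      m + r + 1 - ((Finset.range (m + r + 1)).filter (fun i => NCt P i = NCt Q i)).card := by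
    have : ((Finset.range (m + r + 1)).filter (fun i => NCt P i = NCt Q i)).card + A.card =
        (Finset.range (m + r + 1)).card :=
      Finset.card_filter_add_card_filter_not _
    rw [Finset.card_range] at this
    omega
  have hmem : ∀ i, i ∈ A ↔ i ≤ m + r ∧ NCt P i ≠ NCt Q i := by
    intro i
    simp [hA]
  rw [← hcard, fdim, direction_affineSpan_LPMPoly]
  set D := vectorSpan ℝ (ind (m + r) '' {B | IsLPBasis m r P Q B})
  let f : D →ₗ[ℝ] (A → ℝ) :=
    (LinearMap.pi fun i : A => prefixSum (m + r) (i : ℕ)) ∘ₗ D.subtype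
  have hf : ∀ (x : D) (i : A), f x i = prefixSum (m + r) i x := fun _ _ => rfl
  have hinj : Function.Injective f := by
    rw [injective_iff_map_eq_zero]
    intro x hx
    refine Subtype.ext (eq_zero_of_prefixSum_eq_zero fun i hi => ?_)
    by_cases h : NCt P i = NCt Q i
    · exact prefixSum_eq_zero_of_mem_vectorSpan hi h x.2
    · rw [← hf x ⟨i, (hmem i).2 ⟨hi, h⟩⟩, hx, Pi.zero_apply]
  have hsurj : Function.Surjective f := by
    rw [← LinearMap.range_eq_top, eq_top_iff, ← (Pi.basisFun ℝ A).span_eq, Submodule.span_le]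
    rintro _ ⟨i, rfl⟩
    obtain ⟨x, hx, hxi⟩ := exists_mem_vectorSpan_prefixSum_eq_single hP hQ hPQ ((hmem i).1 i.2).2
    refine ⟨⟨x, hx⟩, ?_⟩
    ext j
    rw [hf, hxi j ((hmem j).1 j.2).1, Pi.basisFun_apply, Pi.single_apply]
    simp only [Subtype.ext_iff]
  rw [(LinearEquiv.ofBijective f ⟨hinj, hsurj⟩).finrank_eq, Module.finrank_fintype_fun_eq_card,
    Fintype.card_coe]
end

section
/- The class of lattice path matroids is closed under restriction: if M is a lattice path matroid on a ground set E (i.e., M is isomorphic to M[P,Q] for some lattice paths P never going above Q with common endpoints) and S ⊆ E, then the restriction M|_S, the matroid on S with bases {B ∩ S : B a basis of M with |B ∩ S| = r(S)} where r(S) is the maximum of |B ∩ S| over bases B, is again a lattice path matroid. -/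
/-- `Bs` (the set of bases of a matroid on ground set `E`) is a lattice path
matroid: there are bounding lattice paths `P`, `Q` and a bijection from `E` to
`{1,…,m+r}` carrying the bases onto the bases of `M[P,Q]`. -/
def IsLatticePathMatroid {E : Type*} (Bs : Set (Finset E)) : Prop :=
  ∃ (m r : ℕ) (P Q : ℕ → Bool), IsPath m r P ∧ IsPath m r Q ∧ Below (m + r) P Q ∧
    ∃ φ : E → ℕ, Set.BijOn φ Set.univ ↑(Finset.Icc 1 (m + r)) ∧
      ∀ B : Finset E, B ∈ Bs ↔ IsLPBasis m r P Q (B.image φ)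

/-- The number of elements of `B` that are at most `i`. -/
def cnt (B : Finset ℕ) (i : ℕ) : ℕ := (B.filter (fun j => j ≤ i)).card

lemma cnt_succ (B : Finset ℕ) (i : ℕ) :
    cnt B (i + 1) = cnt B i + if i + 1 ∈ B then 1 else 0 := by
  unfold cnt
  split_ifs with h
  · have : B.filter (fun j => j ≤ i + 1) = insert (i + 1) (B.filter (fun j => j ≤ i)) := by
      ext j
      simp only [Finset.mem_filter, Finset.mem_insert]
      grind
    rw [this, Finset.card_insert_of_notMem (by simp)]
  · congr 1
    ext j
    simp only [Finset.mem_filter]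
    grind

lemma cnt_mono (B : Finset ℕ) : Monotone (cnt B) :=
  monotone_nat_of_le_succ fun i => by rw [cnt_succ]; omega

lemma cnt_zero {B : Finset ℕ} {n : ℕ} (hB : B ⊆ Finset.Icc 1 n) : cnt B 0 = 0 := by
  unfold cnt
  rw [Finset.card_eq_zero, Finset.filter_eq_empty_iff]
  intro j hj
  have := Finset.mem_Icc.1 (hB hj)
  omega

lemma cnt_of_subset {B : Finset ℕ} {n : ℕ} (hB : B ⊆ Finset.Icc 1 n) : cnt B n = B.card := by
  unfold cnt
  rw [Finset.filter_true_of_mem]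
  intro j hj
  exact (Finset.mem_Icc.1 (hB hj)).2

lemma cnt_le_card (B : Finset ℕ) (i : ℕ) : cnt B i ≤ B.card :=
  Finset.card_filter_le _ _

lemma cnt_union {A C : Finset ℕ} (h : Disjoint A C) (i : ℕ) :
    cnt (A ∪ C) i = cnt A i + cnt C i := by
  unfold cnt
  rw [Finset.filter_union, Finset.card_union_of_disjoint (Finset.disjoint_filter_filter h)]

lemma cnt_insert_erase {B : Finset ℕ} {x y : ℕ} (hx : x ∈ B) (hy : y ∉ B) (i : ℕ) :
    cnt (insert y (B.erase x)) i + (if x ≤ i then 1 else 0) =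
      cnt B i + if y ≤ i then 1 else 0 := by
  have h₁ : cnt B i = cnt (B.erase x) i + if x ≤ i then 1 else 0 := by
    conv_lhs => rw [← Finset.insert_erase hx]
    unfold cnt
    rw [Finset.filter_insert]
    split_ifs
    · rw [Finset.card_insert_of_notMem (by simp)]
    · simp
  have h₂ : cnt (insert y (B.erase x)) i = cnt (B.erase x) i + if y ≤ i then 1 else 0 := by
    unfold cnt
    rw [Finset.filter_insert]
    split_ifs
    · rw [Finset.card_insert_of_notMem (by simp [hy])]
    · simp
  omega

/-- Basis exchange for lattice path matroids: any element of `B₂ \ B₁` can be added to `B₁`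
in exchange for an element of `B₁ \ B₂`. -/
lemma IsLPBasis.exists_exchange {m r : ℕ} {P Q : ℕ → Bool} {B₁ B₂ : Finset ℕ}
    (h₁ : IsLPBasis m r P Q B₁) (h₂ : IsLPBasis m r P Q B₂) {y : ℕ} (hy₂ : y ∈ B₂)
    (hy₁ : y ∉ B₁) :
    ∃ x ∈ B₁, x ∉ B₂ ∧ IsLPBasis m r P Q (insert y (B₁.erase x)) := by
  have hyn := Finset.mem_Icc.1 (h₂.1 hy₂)
  have b₁ : ∀ i ≤ m + r, NCt P i ≤ cnt B₁ i ∧ cnt B₁ i ≤ NCt Q i := h₁.2.2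
  have b₂ : ∀ i ≤ m + r, NCt P i ≤ cnt B₂ i ∧ cnt B₂ i ≤ NCt Q i := h₂.2.2
  have n₁ : cnt B₁ (m + r) = r := (cnt_of_subset h₁.1).trans h₁.2.1
  have n₂ : cnt B₂ (m + r) = r := (cnt_of_subset h₂.1).trans h₂.2.1
  have key : ∀ x ∈ B₁, x ∉ B₂ →
      (∀ i, y ≤ i → i < x → cnt B₁ i < cnt B₂ i) →
      (∀ i, x ≤ i → i < y → cnt B₂ i < cnt B₁ i) →
      ∃ x ∈ B₁, x ∉ B₂ ∧ IsLPBasis m r P Q (insert y (B₁.erase x)) := by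
    intro x hx hx' hup hdown
    refine ⟨x, hx, hx', ?_, ?_, ?_⟩
    · exact Finset.insert_subset (h₂.1 hy₂) ((Finset.erase_subset _ _).trans h₁.1)
    · rw [Finset.card_insert_of_notMem (by simp [hy₁]), Finset.card_erase_add_one hx, h₁.2.1]
    · intro i hi
      change NCt P i ≤ cnt _ i ∧ cnt _ i ≤ NCt Q i
      have e := cnt_insert_erase hx hy₁ i
      have := b₁ i hi
      have := b₂ i hi
      have := hup i
      have := hdown i
      split_ifs at e <;> omega
  obtain ⟨z, rfl⟩ : ∃ z, y = z + 1 := ⟨y - 1, by omega⟩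
  have s₁ := cnt_succ B₁ z
  have s₂ := cnt_succ B₂ z
  rw [if_neg hy₁] at s₁
  rw [if_pos hy₂] at s₂
  by_cases hD : cnt B₁ (z + 1) < cnt B₂ (z + 1)
  · have hex : ∃ x, z + 1 < x ∧
        cnt B₁ (z + 1) + cnt B₂ x < cnt B₁ x + cnt B₂ (z + 1) := by
      refine ⟨m + r, ?_, by omega⟩
      rcases hyn.2.lt_or_eq with h | h
      · exact h
      · rw [h] at hD; omega
    classical
    obtain ⟨hlt, hx⟩ := Nat.find_spec hex
    have hmin := fun {i} => Nat.find_min (m := i) hex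
    generalize Nat.find hex = x at hlt hx hmin
    have hmid : ∀ i, z + 1 ≤ i → i < x →
        cnt B₁ i + cnt B₂ (z + 1) ≤ cnt B₁ (z + 1) + cnt B₂ i := by
      intro i hi hix
      rcases hi.lt_or_eq with h | h
      · have := hmin hix
        push Not at this
        exact this h
      · subst h; omega
    obtain ⟨w, rfl⟩ : ∃ w, x = w + 1 := ⟨x - 1, by omega⟩
    have t₁ := cnt_succ B₁ w
    have t₂ := cnt_succ B₂ w
    have hw := hmid w (by omega) (by omega)
    refine key (w + 1) ?_ ?_ ?_ ?_
    · by_contra h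
      rw [if_neg h] at t₁
      omega
    · intro h
      rw [if_pos h] at t₂
      split_ifs at t₁ <;> omega
    · intro i hi hix
      have := hmid i hi hix
      omega
    · intro i hi hiy
      omega
  · classical
    let p : ℕ → Prop := fun w => cnt B₁ w + cnt B₂ z < cnt B₁ z + cnt B₂ w
    have h0 : p 0 := by
      change _ < _
      rw [cnt_zero h₁.1, cnt_zero h₂.1]
      omega
    have hw : p (Nat.findGreatest p z) := Nat.findGreatest_spec (Nat.zero_le z) h0
    have hle : Nat.findGreatest p z ≤ z := Nat.findGreatest_le z
    have hmax := fun {i} => Nat.findGreatest_is_greatest (P := p) (k := i) (n := z)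
    generalize Nat.findGreatest p z = w at hw hle hmax
    have hwz : w ≠ z := by
      rintro rfl
      exact lt_irrefl _ hw
    have hmid : ∀ i, w < i → i ≤ z → cnt B₁ z + cnt B₂ i ≤ cnt B₁ i + cnt B₂ z :=
      fun i hi hiz => not_lt.1 (hmax hi hiz)
    have hw' : cnt B₁ w + cnt B₂ z < cnt B₁ z + cnt B₂ w := hw
    have t₁ := cnt_succ B₁ w
    have t₂ := cnt_succ B₂ w
    have hw1 := hmid (w + 1) (by omega) (by omega)
    refine key (w + 1) ?_ ?_ ?_ ?_
    · by_contra h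
      rw [if_neg h] at t₁
      omega
    · intro h
      rw [if_pos h] at t₂
      split_ifs at t₁ <;> omega
    · intro i hi hix
      omega
    · intro i hi hiy
      have := hmid i (by omega) (by omega)
      omega

/-- If `B` and `B₀` both meet `S` in the maximum number of elements, then the part of `B` in `S`
together with the part of `B₀` outside `S` is a basis. -/
lemma IsLPBasis.inter_union_sdiff {m r : ℕ} {P Q : ℕ → Bool} {S : Finset ℕ} {s : ℕ}
    (hmax : ∀ B, IsLPBasis m r P Q B → (B ∩ S).card ≤ s) {B B₀ : Finset ℕ}
    (hB : IsLPBasis m r P Q B) (hBs : (B ∩ S).card = s)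
    (hB₀ : IsLPBasis m r P Q B₀) (hB₀s : (B₀ ∩ S).card = s) :
    IsLPBasis m r P Q ((B ∩ S) ∪ (B₀ \ S)) := by
  induction hk : ((B ∩ S) \ B₀).card using Nat.strong_induction_on generalizing B₀ with
  | _ k ih =>
  by_cases hsub : B ∩ S ⊆ B₀
  · have : B ∩ S = B₀ ∩ S :=
      Finset.eq_of_subset_of_card_le
        (Finset.subset_inter hsub Finset.inter_subset_right) (by omega)
    rwa [this, Finset.union_comm, Finset.sdiff_union_inter]
  · obtain ⟨y, hyA, hy⟩ := Finset.not_subset.1 hsub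
    obtain ⟨hyB, hyS⟩ := Finset.mem_inter.1 hyA
    obtain ⟨x, hx, hxB, hnew⟩ := hB₀.exists_exchange hB hyB hy
    have hxS : x ∈ S := by
      by_contra hxS
      have h := hmax _ hnew
      have e : insert y (B₀.erase x) ∩ S = insert y (B₀ ∩ S) := by
        ext j
        simp only [Finset.mem_inter, Finset.mem_insert, Finset.mem_erase]
        grind
      rw [e, Finset.card_insert_of_notMem (by simp [hy])] at h
      omega
    have e₁ : insert y (B₀.erase x) ∩ S = insert y ((B₀ ∩ S).erase x) := by
      ext j
      simp only [Finset.mem_inter, Finset.mem_insert, Finset.mem_erase]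
      grind
    have e₂ : insert y (B₀.erase x) \ S = B₀ \ S := by
      ext j
      simp only [Finset.mem_sdiff, Finset.mem_insert, Finset.mem_erase]
      grind
    have e₃ : (B ∩ S) \ insert y (B₀.erase x) = ((B ∩ S) \ B₀).erase y := by
      ext j
      have : j = x → j ∉ B := fun h => h ▸ hxB
      simp only [Finset.mem_sdiff, Finset.mem_inter, Finset.mem_insert, Finset.mem_erase]
      tauto
    have hyd : y ∈ (B ∩ S) \ B₀ := Finset.mem_sdiff.2 ⟨hyA, hy⟩
    rw [← e₂]
    refine ih _ ?_ hnew ?_ rfl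
    · rw [← hk, e₃]
      exact Finset.card_erase_lt_of_mem hyd
    · rw [e₁, Finset.card_insert_of_notMem (by simp [hy]),
        Finset.card_erase_add_one (Finset.mem_inter.2 ⟨hx, hxS⟩), hB₀s]

lemma exists_NCt_eq {f : ℕ → ℕ} (h0 : f 0 = 0) (h₁ : ∀ i, f i ≤ f (i + 1))
    (h₂ : ∀ i, f (i + 1) ≤ f i + 1) : ∃ P : ℕ → Bool, ∀ i, NCt P i = f i := by
  refine ⟨fun j => decide (f (j - 1) < f j), fun i => ?_⟩
  induction i with
  | zero => simp [NCt, h0]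
  | succ i ih =>
    have := h₁ i
    have := h₂ i
    unfold NCt at ih ⊢
    rw [← Finset.insert_Icc_right_eq_Icc_add_one (by omega), Finset.filter_insert]
    by_cases h : f i < f (i + 1)
    · rw [if_pos (by simpa using h), Finset.card_insert_of_notMem (by simp), ih]
      omega
    · rw [if_neg (by simpa using h), ih]
      omega

/-- A nonempty family of `s`-subsets of `{1, …, k}` that is closed under passing to sets whose
lattice path is pointwise between paths of members is the family of bases of a lattice path
matroid. -/
lemma exists_isLPBasis_iff {k s : ℕ} {F : Set (Finset ℕ)} (hne : F.Nonempty)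
    (hF : ∀ A ∈ F, A ⊆ Finset.Icc 1 k ∧ A.card = s)
    (hconv : ∀ A ⊆ Finset.Icc 1 k, A.card = s →
      (∀ i ≤ k, (∃ A₁ ∈ F, cnt A₁ i ≤ cnt A i) ∧ ∃ A₂ ∈ F, cnt A i ≤ cnt A₂ i) → A ∈ F) :
    ∃ (m : ℕ) (P Q : ℕ → Bool), m + s = k ∧ IsPath m s P ∧ IsPath m s Q ∧ Below (m + s) P Q ∧
      ∀ A, A ∈ F ↔ IsLPBasis m s P Q A := by
  let V : ℕ → Set ℕ := fun i => (fun A => cnt A i) '' F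
  have hV : ∀ i, (V i).Nonempty := fun i => hne.image _
  have hbdd : ∀ i, BddAbove (V i) := by
    refine fun i => ⟨s, ?_⟩
    rintro _ ⟨A, hA, rfl⟩
    exact (cnt_le_card A i).trans (hF A hA).2.le
  have inf_le : ∀ i, ∀ A ∈ F, sInf (V i) ≤ cnt A i := fun i A hA => Nat.sInf_le ⟨A, hA, rfl⟩
  have le_sup : ∀ i, ∀ A ∈ F, cnt A i ≤ sSup (V i) := fun i A hA => le_csSup (hbdd i) ⟨A, hA, rfl⟩
  have inf_mem : ∀ i, ∃ A ∈ F, cnt A i = sInf (V i) := fun i => Nat.sInf_mem (hV i)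
  have sup_mem : ∀ i, ∃ A ∈ F, cnt A i = sSup (V i) := fun i => Nat.sSup_mem (hV i) (hbdd i)
  have succ_le : ∀ (A : Finset ℕ) i, cnt A (i + 1) ≤ cnt A i + 1 := by
    intro A i
    rw [cnt_succ]
    split_ifs <;> omega
  have le_succ : ∀ (A : Finset ℕ) i, cnt A i ≤ cnt A (i + 1) := fun A i => cnt_mono A i.le_succ
  obtain ⟨P, hP⟩ : ∃ P : ℕ → Bool, ∀ i, NCt P i = sInf (V i) := by
    refine exists_NCt_eq ?_ (fun i => ?_) (fun i => ?_)
    · obtain ⟨A, hA, e⟩ := inf_mem 0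
      rw [← e, cnt_zero (hF A hA).1]
    · obtain ⟨A, hA, e⟩ := inf_mem (i + 1)
      rw [← e]
      exact (inf_le i A hA).trans (le_succ A i)
    · obtain ⟨A, hA, e⟩ := inf_mem i
      rw [← e]
      exact (inf_le (i + 1) A hA).trans (succ_le A i)
  obtain ⟨Q, hQ⟩ : ∃ Q : ℕ → Bool, ∀ i, NCt Q i = sSup (V i) := by
    refine exists_NCt_eq ?_ (fun i => ?_) (fun i => ?_)
    · obtain ⟨A, hA, e⟩ := sup_mem 0
      rw [← e, cnt_zero (hF A hA).1]
    · obtain ⟨A, hA, e⟩ := sup_mem i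
      rw [← e]
      exact (le_succ A i).trans (le_sup (i + 1) A hA)
    · obtain ⟨A, hA, e⟩ := sup_mem (i + 1)
      rw [← e]
      exact (succ_le A i).trans (Nat.add_le_add_right (le_sup i A hA) 1)
  have hk : ∀ A ∈ F, cnt A k = s := fun A hA => (cnt_of_subset (hF A hA).1).trans (hF A hA).2
  obtain ⟨A₀, hA₀⟩ := hne
  have hsk : s ≤ k := by
    have := Finset.card_le_card (hF A₀ hA₀).1
    rwa [(hF A₀ hA₀).2, Nat.card_Icc, Nat.add_sub_cancel] at this
  have hsub : k - s + s = k := Nat.sub_add_cancel hsk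
  refine ⟨k - s, P, Q, hsub, ?_, ?_, fun i _ => ?_, fun A => ?_⟩
  · obtain ⟨A, hA, e⟩ := inf_mem k
    rw [IsPath, hsub, hP, ← e, hk A hA]
  · obtain ⟨A, hA, e⟩ := sup_mem k
    rw [IsPath, hsub, hQ, ← e, hk A hA]
  · rw [hP, hQ]
    exact (inf_le i A₀ hA₀).trans (le_sup i A₀ hA₀)
  · unfold IsLPBasis
    simp only [hsub, hP, hQ]
    refine ⟨fun hA => ⟨(hF A hA).1, (hF A hA).2, fun i _ => ⟨inf_le i A hA, le_sup i A hA⟩⟩, ?_⟩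
    rintro ⟨hA, hs, hb⟩
    refine hconv A hA hs fun i hi => ?_
    obtain ⟨A₁, hA₁, e₁⟩ := inf_mem i
    obtain ⟨A₂, hA₂, e₂⟩ := sup_mem i
    exact ⟨⟨A₁, hA₁, e₁.trans_le (hb i hi).1⟩, A₂, hA₂, (hb i hi).2.trans_eq e₂.symm⟩

lemma cnt_lt_cnt {S : Finset ℕ} {i j : ℕ} (hj : j ∈ S) (hij : i < j) : cnt S i < cnt S j := by
  obtain ⟨w, rfl⟩ : ∃ w, j = w + 1 := ⟨j - 1, by omega⟩
  have := cnt_mono S (Nat.le_of_lt_succ hij)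
  rw [cnt_succ, if_pos hj]
  omega

lemma cnt_le_cnt_iff {S : Finset ℕ} {i j : ℕ} (hj : j ∈ S) : cnt S j ≤ cnt S i ↔ j ≤ i :=
  ⟨fun h => not_lt.1 fun hij => (cnt_lt_cnt hj hij).not_ge h, fun h => cnt_mono S h⟩

lemma injOn_cnt (S : Finset ℕ) : Set.InjOn (cnt S) S := fun _ ha _ hb h =>
  le_antisymm ((cnt_le_cnt_iff ha).1 h.le) ((cnt_le_cnt_iff hb).1 h.ge)

lemma image_cnt (S : Finset ℕ) (h0 : 0 ∉ S) : S.image (cnt S) = Finset.Icc 1 S.card := by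
  refine Finset.eq_of_subset_of_card_le ?_ ?_
  · intro x hx
    obtain ⟨j, hj, rfl⟩ := Finset.mem_image.1 hx
    have : 0 < j := Nat.pos_of_ne_zero fun h => h0 (h ▸ hj)
    have := cnt_lt_cnt hj this
    exact Finset.mem_Icc.2 ⟨by omega, cnt_le_card S j⟩
  · rw [Finset.card_image_of_injOn (injOn_cnt S), Nat.card_Icc, Nat.add_sub_cancel]

lemma cnt_image_cnt {S A : Finset ℕ} (hA : A ⊆ S) (i : ℕ) :
    cnt (A.image (cnt S)) (cnt S i) = cnt A i := by
  have : (A.image (cnt S)).filter (fun j => j ≤ cnt S i) =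
      (A.filter (fun j => j ≤ i)).image (cnt S) := by
    rw [Finset.filter_image]
    congr 1
    exact Finset.filter_congr fun j hj => cnt_le_cnt_iff (hA hj)
  unfold cnt at this ⊢
  rw [this]
  exact Finset.card_image_of_injOn ((injOn_cnt S).mono fun j hj =>
    hA (Finset.mem_filter.1 hj).1)

/-- Restriction of a lattice path matroid on `{1, …, m + r}`, with the elements of `S` relabelled
in increasing order. -/
lemma exists_isLPBasis_restrict {m r : ℕ} {P Q : ℕ → Bool} {S : Finset ℕ}
    (hS : S ⊆ Finset.Icc 1 (m + r)) {s : ℕ}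
    (hmax : ∀ B, IsLPBasis m r P Q B → (B ∩ S).card ≤ s)
    (hex : ∃ B, IsLPBasis m r P Q B ∧ (B ∩ S).card = s) :
    ∃ (m' : ℕ) (P' Q' : ℕ → Bool), m' + s = S.card ∧ IsPath m' s P' ∧ IsPath m' s Q' ∧
      Below (m' + s) P' Q' ∧ ∀ A ⊆ S,
        (∃ B, IsLPBasis m r P Q B ∧ (B ∩ S).card = s ∧ B ∩ S = A) ↔
          IsLPBasis m' s P' Q' (A.image (cnt S)) := by
  obtain ⟨B₀, hB₀, hB₀s⟩ := hex
  have h0 : 0 ∉ S := fun h => by simpa using hS h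
  have hinj := injOn_cnt S
  let F : Set (Finset ℕ) :=
    {A' | ∃ B, IsLPBasis m r P Q B ∧ (B ∩ S).card = s ∧ A' = (B ∩ S).image (cnt S)}
  have hF : ∀ A ∈ F, A ⊆ Finset.Icc 1 S.card ∧ A.card = s := by
    rintro _ ⟨B, hB, hBs, rfl⟩
    refine ⟨?_, ?_⟩
    · rw [← image_cnt S h0]
      exact Finset.image_subset_image Finset.inter_subset_right
    · rw [Finset.card_image_of_injOn (hinj.mono (by simp)), hBs]
  have hconv : ∀ A ⊆ Finset.Icc 1 S.card, A.card = s → (∀ i ≤ S.card,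
      (∃ A₁ ∈ F, cnt A₁ i ≤ cnt A i) ∧ ∃ A₂ ∈ F, cnt A i ≤ cnt A₂ i) → A ∈ F := by
    intro A' hA' hs hb
    rw [← image_cnt S h0] at hA'
    obtain ⟨A, hA, rfl⟩ := Finset.subset_image_iff.1 hA'
    replace hA : A ⊆ S := by exact_mod_cast hA
    rw [Finset.card_image_of_injOn (hinj.mono (by exact_mod_cast hA))] at hs
    have hdisj : ∀ X ⊆ S, Disjoint X (B₀ \ S) := fun X hX =>
      Finset.disjoint_of_subset_left hX Finset.disjoint_sdiff
    have hAS : (A ∪ B₀ \ S) ∩ S = A := by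
      ext j
      have := @hA j
      simp only [Finset.mem_inter, Finset.mem_union, Finset.mem_sdiff]
      tauto
    refine ⟨A ∪ (B₀ \ S), ⟨?_, ?_, fun i hi => ?_⟩, by rw [hAS, hs], by rw [hAS]⟩
    · exact Finset.union_subset (hA.trans hS) (Finset.sdiff_subset.trans hB₀.1)
    · rw [Finset.card_union_of_disjoint (hdisj A hA), hs, ← hB₀s,
        Finset.card_inter_add_card_sdiff, hB₀.2.1]
    · change NCt P i ≤ cnt _ i ∧ cnt _ i ≤ NCt Q i
      obtain ⟨⟨_, ⟨B₁, hB₁, hs₁, rfl⟩, l₁⟩, _, ⟨B₂, hB₂, hs₂, rfl⟩, l₂⟩ :=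
        hb (cnt S i) (cnt_le_card S i)
      rw [cnt_image_cnt hA, cnt_image_cnt Finset.inter_subset_right] at l₁ l₂
      have c₁ : NCt P i ≤ cnt _ i :=
        ((IsLPBasis.inter_union_sdiff hmax hB₁ hs₁ hB₀ hB₀s).2.2 i hi).1
      have c₂ : cnt _ i ≤ NCt Q i :=
        ((IsLPBasis.inter_union_sdiff hmax hB₂ hs₂ hB₀ hB₀s).2.2 i hi).2
      rw [cnt_union (hdisj _ Finset.inter_subset_right)] at c₁ c₂
      rw [cnt_union (hdisj A hA)]
      omega
  obtain ⟨m', P', Q', h₁, h₂, h₃, h₄, h₅⟩ :=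
    exists_isLPBasis_iff (F := F) ⟨_, B₀, hB₀, hB₀s, rfl⟩ hF hconv
  refine ⟨m', P', Q', h₁, h₂, h₃, h₄, fun A hA => ?_⟩
  rw [← h₅]
  constructor
  · rintro ⟨B, hB, hBs, rfl⟩
    exact ⟨B, hB, hBs, rfl⟩
  · rintro ⟨B, hB, hBs, e⟩
    refine ⟨B, hB, hBs, ?_⟩
    have e' := congrArg (fun X : Finset ℕ => (X : Set ℕ)) e
    simp only [Finset.coe_image] at e'
    exact Finset.coe_injective ((hinj.image_eq_image_iff (by exact_mod_cast hA)
      (by simp)).1 e').symm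

/-- The class of lattice path matroids is closed under restriction. -/
theorem lpm_restriction {E : Type*} [DecidableEq E] (Bs : Set (Finset E))
    (hM : IsLatticePathMatroid Bs) (S : Finset E) (rS : ℕ)
    (hrS : IsGreatest ((fun B => (B ∩ S).card) '' Bs) rS) :
    IsLatticePathMatroid
      {B' : Finset {x // x ∈ S} | ∃ B ∈ Bs, (B ∩ S).card = rS ∧
        B' = (B ∩ S).subtype (· ∈ S)} := by
  obtain ⟨m, r, P, Q, -, -, -, φ, hφ, hBs⟩ := hM
  have hinj : Function.Injective φ := Set.injOn_univ.1 hφ.injOn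
  have hlift : ∀ B, IsLPBasis m r P Q B → ∃ B' ∈ Bs, B'.image φ = B := by
    intro B hB
    have hsub : (B : Set ℕ) ⊆ φ '' Set.univ := by
      rw [hφ.image_eq]
      exact_mod_cast hB.1
    obtain ⟨B', -, rfl⟩ := Finset.subset_set_image_iff.1 hsub
    exact ⟨B', (hBs B').2 hB, rfl⟩
  have hcard : ∀ B : Finset E, (B.image φ ∩ S.image φ).card = (B ∩ S).card := fun B => by
    rw [← Finset.image_inter _ _ hinj, Finset.card_image_of_injective _ hinj]
  have hS : S.image φ ⊆ Finset.Icc 1 (m + r) := by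
    intro j hj
    obtain ⟨x, -, rfl⟩ := Finset.mem_image.1 hj
    exact_mod_cast hφ.mapsTo (Set.mem_univ x)
  obtain ⟨⟨B₀, hB₀, hB₀s⟩, hub⟩ := hrS
  obtain ⟨m', P', Q', h₁, h₂, h₃, h₄, h₅⟩ := exists_isLPBasis_restrict (P := P) (Q := Q) hS (s := rS)
    (fun B hB => by
      obtain ⟨B', hB', rfl⟩ := hlift B hB
      rw [hcard]
      exact hub ⟨B', hB', rfl⟩)
    ⟨B₀.image φ, (hBs B₀).1 hB₀, (hcard B₀).trans hB₀s⟩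
  have hψ := injOn_cnt (S.image φ)
  have h0 : 0 ∉ S.image φ := fun h => by simpa using hS h
  refine ⟨m', rS, P', Q', h₂, h₃, h₄, fun x => cnt (S.image φ) (φ x), ⟨?_, ?_, ?_⟩, fun B' => ?_⟩
  · intro x _
    rw [h₁, ← image_cnt _ h0, Finset.mem_coe]
    exact Finset.mem_image_of_mem _ (Finset.mem_image_of_mem _ x.2)
  · intro x _ y _ hxy
    exact Subtype.ext (hinj (hψ (Finset.mem_image_of_mem _ x.2)
      (Finset.mem_image_of_mem _ y.2) hxy))
  · intro j hj
    rw [h₁, ← image_cnt _ h0, Finset.mem_coe, Finset.image_image] at hj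
    obtain ⟨x, hx, rfl⟩ := Finset.mem_image.1 hj
    exact ⟨⟨x, hx⟩, Set.mem_univ _, rfl⟩
  · have e : B'.image (fun x : {x // x ∈ S} => cnt (S.image φ) (φ x)) =
        ((B'.map (Function.Embedding.subtype _)).image φ).image (cnt (S.image φ)) := by
      ext j
      simp
    have hB'S : B'.map (Function.Embedding.subtype _) ⊆ S := by
      intro x hx
      obtain ⟨y, -, rfl⟩ := Finset.mem_map.1 hx
      exact y.2
    rw [e, ← h₅ _ (Finset.image_subset_image hB'S)]
    have heq : ∀ B : Finset E, B' = (B ∩ S).subtype (· ∈ S) ↔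
        B ∩ S = B'.map (Function.Embedding.subtype _) := by
      intro B
      rw [← Finset.map_inj (f := Function.Embedding.subtype (· ∈ S)), Finset.subtype_map_of_mem
        fun x hx => (Finset.mem_inter.1 hx).2, eq_comm]
    constructor
    · rintro ⟨B, hB, hBs', hB'⟩
      refine ⟨B.image φ, (hBs B).1 hB, (hcard B).trans hBs', ?_⟩
      rw [← Finset.image_inter _ _ hinj, (heq B).1 hB']
    · rintro ⟨_, hB, hBs', hB'⟩
      obtain ⟨B, hBmem, rfl⟩ := hlift _ hB
      refine ⟨B, hBmem, (hcard B).symm.trans hBs', (heq B).2 ?_⟩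
      rw [← Finset.image_inter _ _ hinj] at hB'
      exact Finset.image_injective hinj hB'
end

section
/- Let P, Q be lattice paths from (0,0) to (m,r) with P never going above Q such that [P,Q] is a border strip. Then the lattice path matroid polytope P(M[P,Q]) has the hyperplane description: P(M[P,Q]) = { x ∈ ℝ^{m+r} : x_1 + ⋯ + x_{m+r} = r, 0 ≤ x_i ≤ 1 for all i ∈ {1,…,m+r}, and N(P,i) ≤ x_1 + ⋯ + x_i ≤ N(Q,i) for all i ∈ {1,…,m+r} }. -/
/-- The sum of the first `i` coordinates of `x`. -/
def partialSum {n : ℕ} (x : Fin n → ℝ) (i : ℕ) : ℝ :=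
  ∑ j : Fin n, if (j : ℕ) + 1 ≤ i then x j else 0

lemma partialSum_zero {n : ℕ} (x : Fin n → ℝ) : partialSum x 0 = 0 := by
  simp [partialSum]

lemma partialSum_succ {n : ℕ} (x : Fin n → ℝ) (k : Fin n) :
    partialSum x (k + 1) = partialSum x k + x k := by
  have hk : x k = ∑ j : Fin n, if j = k then x j else 0 := by simp
  rw [hk, partialSum, partialSum, ← Finset.sum_add_distrib]
  refine Finset.sum_congr rfl fun j _ => ?_
  rcases lt_trichotomy j k with h | h | h
  · have h' : (j : ℕ) < k := h
    simp [h.ne, h'.le, Nat.succ_le_of_lt h']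
  · simp [h]
  · have h' : (k : ℕ) < j := h
    simp [h.ne', show ¬ ((j : ℕ) ≤ k) by omega, show ¬ ((j : ℕ) + 1 ≤ k) by omega]

lemma partialSum_self {n : ℕ} (x : Fin n → ℝ) : partialSum x n = ∑ i, x i := by
  refine Finset.sum_congr rfl fun j _ => ?_
  simp [Nat.succ_le_of_lt j.isLt]

lemma partialSum_smul_add_smul {n : ℕ} (x y : Fin n → ℝ) (a b : ℝ) (i : ℕ) :
    partialSum (a • x + b • y) i = a * partialSum x i + b * partialSum y i := by
  simp only [partialSum, Finset.mul_sum, ← Finset.sum_add_distrib]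
  refine Finset.sum_congr rfl fun j _ => ?_
  split_ifs <;> simp

lemma partialSum_ind {n : ℕ} {B : Finset ℕ} (hB : B ⊆ Finset.Icc 1 n) {i : ℕ} (hi : i ≤ n) :
    partialSum (ind n B) i = (B.filter (fun j => j ≤ i)).card := by
  induction i with
  | zero =>
    rw [partialSum_zero, Finset.filter_false_of_mem]
    · simp
    · intro j hj
      have := Finset.mem_Icc.1 (hB hj)
      omega
  | succ k ih =>
    have hk := partialSum_succ (ind n B) ⟨k, hi⟩
    simp only at hk
    rw [hk, ih (by omega)]
    by_cases h : k + 1 ∈ B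
    · have : B.filter (fun j => j ≤ k + 1) = insert (k + 1) (B.filter (fun j => j ≤ k)) := by
        ext j
        simp only [Finset.mem_filter, Finset.mem_insert]
        grind
      rw [this, Finset.card_insert_of_notMem (by simp)]
      simp [ind, h]
    · have : B.filter (fun j => j ≤ k + 1) = B.filter (fun j => j ≤ k) := by
        ext j
        simp only [Finset.mem_filter]
        grind
      simp [ind, h, this]

/-- The steps at which the rounded partial sums `⌊x_1 + ⋯ + x_i + t⌋` jump. -/
noncomputable def roundedSet {n : ℕ} (x : Fin n → ℝ) (t : ℝ) : Finset ℕ :=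
  (Finset.Icc 1 n).filter fun i => ⌊partialSum x (i - 1) + t⌋ ≠ ⌊partialSum x i + t⌋

lemma ind_roundedSet {n : ℕ} {x : Fin n → ℝ} (hx : ∀ i, 0 ≤ x i ∧ x i ≤ 1) (t : ℝ) (k : Fin n) :
    ind n (roundedSet x t) k = ⌊partialSum x (k + 1) + t⌋ - ⌊partialSum x k + t⌋ := by
  have hmem : (k : ℕ) + 1 ∈ roundedSet x t ↔
      ⌊partialSum x k + t⌋ ≠ ⌊partialSum x (k + 1) + t⌋ := by
    simp [roundedSet]
  have h1 : ⌊partialSum x k + t⌋ ≤ ⌊partialSum x (k + 1) + t⌋ := by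
    apply Int.floor_le_floor
    rw [partialSum_succ]
    linarith [(hx k).1]
  have h2 : ⌊partialSum x (k + 1) + t⌋ ≤ ⌊partialSum x k + t⌋ + 1 := by
    rw [← Int.floor_add_one]
    apply Int.floor_le_floor
    rw [partialSum_succ]
    linarith [(hx k).2]
  unfold ind
  split_ifs with h
  · rw [hmem] at h
    have : ⌊partialSum x (k + 1) + t⌋ = ⌊partialSum x k + t⌋ + 1 := by omega
    rw [this]
    push_cast
    ring
  · rw [hmem, not_not] at h
    rw [h, sub_self]

lemma card_roundedSet_filter {n : ℕ} {x : Fin n → ℝ} (hx : ∀ i, 0 ≤ x i ∧ x i ≤ 1) {t : ℝ}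
    (ht : t ∈ Set.Ico (0 : ℝ) 1) {i : ℕ} (hi : i ≤ n) :
    (((roundedSet x t).filter (fun j => j ≤ i)).card : ℤ) = ⌊partialSum x i + t⌋ := by
  have key : partialSum (ind n (roundedSet x t)) i = ⌊partialSum x i + t⌋ := by
    induction i with
    | zero =>
      have : ⌊t⌋ = 0 := Int.floor_eq_zero_iff.2 ht
      simp [partialSum_zero, this]
    | succ k ih =>
      have hk := partialSum_succ (ind n (roundedSet x t)) ⟨k, hi⟩
      have hr := ind_roundedSet hx t ⟨k, hi⟩
      simp only at hk hr
      rw [hk, ih (by omega), hr]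
      ring
  have hsub : roundedSet x t ⊆ Finset.Icc 1 n := Finset.filter_subset _ _
  rw [partialSum_ind hsub hi] at key
  exact_mod_cast key

lemma roundedSet_isLPBasis {m r : ℕ} {P Q : ℕ → Bool} {x : Fin (m + r) → ℝ}
    (hsum : ∑ i, x i = r) (hx : ∀ i, 0 ≤ x i ∧ x i ≤ 1)
    (hPQ : ∀ i ∈ Finset.Icc 1 (m + r),
      (NCt P i : ℝ) ≤ partialSum x i ∧ partialSum x i ≤ NCt Q i)
    {t : ℝ} (ht : t ∈ Set.Ico (0 : ℝ) 1) : IsLPBasis m r P Q (roundedSet x t) := by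
  have hsub : roundedSet x t ⊆ Finset.Icc 1 (m + r) := Finset.filter_subset _ _
  refine ⟨hsub, ?_, fun i hi => ?_⟩
  · have h := card_roundedSet_filter hx ht le_rfl
    rw [Finset.filter_true_of_mem fun j hj => (Finset.mem_Icc.1 (hsub hj)).2,
      partialSum_self, hsum, Int.floor_natCast_add, Int.floor_eq_zero_iff.2 ht, add_zero] at h
    exact_mod_cast h
  · have hbd : (NCt P i : ℝ) ≤ partialSum x i ∧ partialSum x i ≤ NCt Q i := by
      rcases Nat.eq_zero_or_pos i with rfl | h0
      · simp [partialSum_zero, NCt]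
      · exact hPQ i (Finset.mem_Icc.2 ⟨h0, hi⟩)
    have h := card_roundedSet_filter hx ht hi
    have hl : (NCt P i : ℤ) ≤ ⌊partialSum x i + t⌋ := by
      rw [Int.le_floor]
      push_cast
      linarith [ht.1]
    have hu : ⌊partialSum x i + t⌋ < (NCt Q i : ℤ) + 1 := by
      rw [Int.floor_lt]
      push_cast
      linarith [ht.2]
    omega

lemma floor_add_eq_indicator (s : ℝ) {t : ℝ} (ht : t ∈ Set.Ico (0 : ℝ) 1) :
    (⌊s + t⌋ : ℝ) = ⌊s⌋ + (Set.Ici (1 - Int.fract s)).indicator (fun _ => (1 : ℝ)) t := by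
  have h0 := Int.fract_nonneg s
  have h1 := Int.fract_lt_one s
  have hs := Int.floor_add_fract s
  by_cases h : 1 - Int.fract s ≤ t
  · have : ⌊s + t⌋ = ⌊s⌋ + 1 := by
      rw [Int.floor_eq_iff]
      push_cast
      constructor <;> linarith [ht.2]
    simp [this, h]
  · have : ⌊s + t⌋ = ⌊s⌋ := by
      rw [Int.floor_eq_iff]
      constructor <;> linarith [ht.1]
    simp [this, h]

open MeasureTheory in
lemma integrable_floor_add (s : ℝ) :
    Integrable (fun t : ℝ => (⌊s + t⌋ : ℝ)) (volume.restrict (Set.Ico (0 : ℝ) 1)) := by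
  have hi : Integrable
      (fun t : ℝ => (⌊s⌋ : ℝ) + (Set.Ici (1 - Int.fract s)).indicator (fun _ => (1 : ℝ)) t)
      (volume.restrict (Set.Ico (0 : ℝ) 1)) :=
    (integrable_const _).add ((integrable_const _).indicator measurableSet_Ici)
  refine hi.congr ?_
  filter_upwards [ae_restrict_mem measurableSet_Ico] with t ht
  exact (floor_add_eq_indicator s ht).symm

open MeasureTheory in
lemma integral_floor_add (s : ℝ) : ∫ t in Set.Ico (0 : ℝ) 1, (⌊s + t⌋ : ℝ) = s := by
  have h0 := Int.fract_nonneg s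
  have h1 := Int.fract_lt_one s
  rw [setIntegral_congr_fun measurableSet_Ico fun t ht => floor_add_eq_indicator s ht,
    integral_add (integrable_const _) ((integrable_const _).indicator measurableSet_Ici),
    integral_indicator measurableSet_Ici, Measure.restrict_restrict measurableSet_Ici]
  have hset : Set.Ici (1 - Int.fract s) ∩ Set.Ico 0 1 = Set.Ico (1 - Int.fract s) 1 := by
    ext t
    simp only [Set.mem_inter_iff, Set.mem_Ici, Set.mem_Ico]
    constructor
    · rintro ⟨h, -, h'⟩
      exact ⟨h, h'⟩
    · rintro ⟨h, h'⟩
      exact ⟨h, by linarith, h'⟩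
  rw [hset]
  simp [h0, Int.floor_add_fract]

open MeasureTheory in
/-- A point satisfying the inequalities is the average of the indicator vectors of its rounded
sets, which are bases. -/
lemma mem_LPMPoly_of_partialSum_bounds {m r : ℕ} {P Q : ℕ → Bool} {x : Fin (m + r) → ℝ}
    (hsum : ∑ i, x i = r) (hx : ∀ i, 0 ≤ x i ∧ x i ≤ 1)
    (hPQ : ∀ i ∈ Finset.Icc 1 (m + r),
      (NCt P i : ℝ) ≤ partialSum x i ∧ partialSum x i ≤ NCt Q i) :
    x ∈ LPMPoly m r P Q := by
  let μ : Measure ℝ := volume.restrict (Set.Ico (0 : ℝ) 1)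
  have : IsProbabilityMeasure μ := ⟨by simp [μ]⟩
  have hfin : {B | IsLPBasis m r P Q B}.Finite :=
    (Finset.Icc 1 (m + r)).powerset.finite_toSet.subset fun B hB =>
      Finset.mem_coe.2 (Finset.mem_powerset.2 hB.1)
  have hclosed : IsClosed (LPMPoly m r P Q) := (hfin.image _).isClosed_convexHull ℝ
  have hint : ∀ k, Integrable (fun t => ind (m + r) (roundedSet x t) k) μ := fun k => by
    simp only [ind_roundedSet hx]
    exact (integrable_floor_add _).sub (integrable_floor_add _)
  have hmem : ∫ t, ind (m + r) (roundedSet x t) ∂μ ∈ LPMPoly m r P Q := by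
    refine (convex_convexHull ℝ _).integral_mem hclosed ?_ (Integrable.of_eval hint)
    filter_upwards [ae_restrict_mem measurableSet_Ico] with t ht
    exact subset_convexHull ℝ _ ⟨_, roundedSet_isLPBasis hsum hx hPQ ht, rfl⟩
  convert hmem using 1
  ext k
  rw [eval_integral hint]
  simp only [ind_roundedSet hx]
  rw [integral_sub (integrable_floor_add _) (integrable_floor_add _), integral_floor_add,
    integral_floor_add, partialSum_succ]
  ring

/-- For a border strip `[P,Q]`, the lattice path matroid polytope has the
hyperplane description `{x : ∑ x_i = r, 0 ≤ x_i ≤ 1, and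
N(P,i) ≤ x_1 + ⋯ + x_i ≤ N(Q,i) for all i}`. -/
theorem border_strip_hyperplane_description (m r : ℕ) (P Q : ℕ → Bool)
    (hP : IsPath m r P) (hQ : IsPath m r Q) (hPQ : Below (m + r) P Q)
    (hBS : ∀ i, 0 < i → i < m + r → NCt Q i = NCt P i + 1) :
    LPMPoly m r P Q =
      {x : Fin (m + r) → ℝ |
        (∑ i, x i) = r ∧
        (∀ i, 0 ≤ x i ∧ x i ≤ 1) ∧
        ∀ i ∈ Finset.Icc 1 (m + r),
          ((NCt P i : ℝ) ≤ ∑ j : Fin (m + r), (if (j : ℕ) + 1 ≤ i then x j else 0) ∧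
            (∑ j : Fin (m + r), (if (j : ℕ) + 1 ≤ i then x j else 0)) ≤ (NCt Q i : ℝ))} := by
  refine Set.Subset.antisymm (convexHull_min ?_ ?_) ?_
  · rintro _ ⟨B, ⟨hB, hcard, hbd⟩, rfl⟩
    refine ⟨?_, fun i => ?_, fun i hi => ?_⟩
    · rw [← partialSum_self, partialSum_ind hB le_rfl,
        Finset.filter_true_of_mem fun j hj => (Finset.mem_Icc.1 (hB hj)).2, hcard]
    · unfold ind
      split_ifs <;> simp
    · have hi' := (Finset.mem_Icc.1 hi).2
      have h := partialSum_ind hB hi'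
      unfold partialSum at h
      rw [h]
      exact_mod_cast hbd i hi'
  · rintro x ⟨hxs, hx, hxb⟩ y ⟨hys, hy, hyb⟩ a b ha hb hab
    refine ⟨?_, fun i => ?_, fun i hi => ?_⟩
    · rw [← partialSum_self, partialSum_smul_add_smul, partialSum_self, partialSum_self, hxs, hys,
        ← add_mul, hab, one_mul]
    · exact convex_Icc (0 : ℝ) 1 (hx i) (hy i) ha hb hab
    · have h := partialSum_smul_add_smul x y a b i
      unfold partialSum at h
      rw [h]
      exact convex_Icc (NCt P i : ℝ) (NCt Q i) (hxb i hi) (hyb i hi) ha hb hab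
  · rintro x ⟨hsum, hx, hb⟩
    exact mem_LPMPoly_of_partialSum_bounds hsum hx hb
end

section
/- Let P, Q be lattice paths from (0,0) to (m,r) with P never going above Q. For a lattice path L from (0,0) to (m,r) with P ≤ L ≤ Q, define L' = L'(P,L) to be the unique lattice path from (0,0) to (m,r) such that N(L',i) = N(P,i) whenever N(L,i) = N(P,i), and on each maximal interval {s, s+1, …, t} with N(L,i) > N(P,i) for s < i < t (so N(L,s) = N(P,s) and N(L,t) = N(P,t)), L' consists of all East steps followed by all North steps (L' = E^a N^b from the point after step s to the point after step t, where a and b are the numbers of E's and N's of L in that interval). Then the number of edges (one-dimensional faces) of the lattice path matroid polytope P(M[P,Q]) equals the sum, over all lattice paths L from (0,0) to (m,r) with P ≤ L ≤ Q, of the area between L' and L, namely Σ_{i=1}^{m+r} (N(L,i) − N(L',i)). -/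
/-- The finite set of all bases of `M[P,Q]`; these correspond bijectively to the
lattice paths `L` from `(0,0)` to `(m,r)` with `P ≤ L ≤ Q` (a basis is the set of
positions of the North steps of `L`). -/
noncomputable def basesFinset (m r : ℕ) (P Q : ℕ → Bool) : Finset (Finset ℕ) :=
  letI := Classical.decPred (IsLPBasis m r P Q)
  (Finset.Icc 1 (m + r)).powerset.filter (IsLPBasis m r P Q)

/-- `pathN B i` is the number of North steps among the first `i` steps of the
lattice path whose North steps are at the positions in `B`. -/
def pathN (B : Finset ℕ) (i : ℕ) : ℕ := (B.filter (fun j => j ≤ i)).card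

/-- The largest `s ≤ i` at which the path of `B` touches `P`. -/
noncomputable def lastTouch (P : ℕ → Bool) (B : Finset ℕ) (i : ℕ) : ℕ :=
  sSup {s | s ≤ i ∧ pathN B s = NCt P s}

/-- The smallest `t ≥ i` at which the path of `B` touches `P`. -/
noncomputable def nextTouch (P : ℕ → Bool) (B : Finset ℕ) (i : ℕ) : ℕ :=
  sInf {t | i ≤ t ∧ pathN B t = NCt P t}

/-- The number of North steps among the first `i` steps of the path `L'(P,L)`,
where `L` is the path of `B`: `L'` agrees with `L` at every touching point with
`P`, and on each maximal interval strictly above `P` it consists of all East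
steps followed by all North steps. -/
noncomputable def NLp (P : ℕ → Bool) (B : Finset ℕ) (i : ℕ) : ℕ :=
  max (NCt P (lastTouch P B i))
    (pathN B (nextTouch P B i) - (nextTouch P B i - i))

namespace LatticePathMatroid

open Finset

lemma pathN_zero {n : ℕ} {B : Finset ℕ} (hB : B ⊆ Icc 1 n) : pathN B 0 = 0 := by
  rw [pathN, card_eq_zero, filter_eq_empty_iff]
  intro j hj h
  have := mem_Icc.1 (hB hj)
  omega

lemma pathN_succ (B : Finset ℕ) (i : ℕ) :
    pathN B (i + 1) = pathN B i + if i + 1 ∈ B then 1 else 0 := by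
  unfold pathN
  split_ifs with h
  · rw [show B.filter (· ≤ i + 1) = insert (i + 1) (B.filter (· ≤ i)) by grind]
    rw [card_insert_of_notMem (by simp)]
  · congr 1
    grind

lemma card_filter_mem_Ioc (B : Finset ℕ) {i t : ℕ} (h : i ≤ t) :
    ((Ioc i t).filter (· ∈ B)).card + pathN B i = pathN B t := by
  induction t, h using Nat.le_induction with
  | base => simp
  | succ t h ih =>
    rw [pathN_succ, ← ih, ← insert_Ioc_right_eq_Ioc_add_one h, filter_insert]
    split_ifs with h1
    · rw [card_insert_of_notMem (by simp)]
      omega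
    · rfl

lemma card_filter_notMem_Ioc (B : Finset ℕ) {i t : ℕ} (h : i ≤ t) :
    ((Ioc i t).filter (· ∉ B)).card + pathN B t = t - i + pathN B i := by
  have h1 := card_filter_mem_Ioc B h
  have h2 := card_filter_add_card_filter_not (s := Ioc i t) (· ∈ B)
  rw [Nat.card_Ioc] at h2
  omega

lemma pathN_eq_card {n i : ℕ} {B : Finset ℕ} (hB : B ⊆ Icc 1 n) (hi : n ≤ i) :
    pathN B i = B.card := by
  unfold pathN
  congr 1
  rw [filter_eq_self]
  intro j hj
  exact (mem_Icc.1 (hB hj)).2.trans hi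

lemma pathN_exchange {B : Finset ℕ} {e f : ℕ} (he : e ∈ B) (hf : f ∉ B) (hef : e < f) (i : ℕ) :
    pathN (insert f (B.erase e)) i + (if e ≤ i ∧ i < f then 1 else 0) = pathN B i := by
  unfold pathN
  have h1 : f ∉ (B.erase e).filter (· ≤ i) := by simp [hf]
  have h2 : e ≤ i → e ∈ B.filter (· ≤ i) := by simp [he]
  rw [filter_insert, filter_erase]
  rw [filter_erase] at h1
  by_cases hi : e ≤ i
  · have h3 := card_erase_add_one (h2 hi)
    by_cases hi' : f ≤ i
    · rw [if_pos hi', card_insert_of_notMem h1, if_neg (by omega)]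
      omega
    · rw [if_neg hi', if_pos (by omega)]
      omega
  · rw [if_neg (by omega), if_neg (by omega), erase_eq_of_notMem (by simp [hi])]
    omega

/-- The positions `e < f` from which a North step can be moved to position `f`, lowering the path
of `B` without crossing `P`. -/
def loweringStarts (P : ℕ → Bool) (B : Finset ℕ) (f : ℕ) : Finset ℕ :=
  (Ico 1 f).filter fun e => f ∉ B ∧ e ∈ B ∧ ∀ i ∈ Ico e f, NCt P i < pathN B i

/-- The exchanges `(f, e)` that lower the path of `B`, by moving a North step from position `e`
to a later position `f`, without crossing `P`. -/
def loweringPairs (n : ℕ) (P : ℕ → Bool) (B : Finset ℕ) : Finset (Σ _ : ℕ, ℕ) :=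
  (Icc 1 n).sigma (loweringStarts P B)

section Touch

variable {n : ℕ} {P : ℕ → Bool} {B : Finset ℕ}

lemma lastTouch_mem (h0 : pathN B 0 = NCt P 0) (i : ℕ) :
    lastTouch P B i ≤ i ∧ pathN B (lastTouch P B i) = NCt P (lastTouch P B i) :=
  Nat.sSup_mem (s := {s | s ≤ i ∧ pathN B s = NCt P s}) ⟨0, Nat.zero_le i, h0⟩ ⟨i, fun _ h => h.1⟩

lemma le_lastTouch {i j : ℕ} (hj : j ≤ i) (h : pathN B j = NCt P j) : j ≤ lastTouch P B i :=
  le_csSup (s := {s | s ≤ i ∧ pathN B s = NCt P s}) ⟨i, fun _ h => h.1⟩ ⟨hj, h⟩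

lemma nextTouch_mem (hn : pathN B n = NCt P n) {i : ℕ} (hi : i ≤ n) :
    i ≤ nextTouch P B i ∧ pathN B (nextTouch P B i) = NCt P (nextTouch P B i) :=
  Nat.sInf_mem (s := {t | i ≤ t ∧ pathN B t = NCt P t}) ⟨n, hi, hn⟩

lemma nextTouch_le {i j : ℕ} (hj : i ≤ j) (h : pathN B j = NCt P j) : nextTouch P B i ≤ j :=
  Nat.sInf_le (s := {t | i ≤ t ∧ pathN B t = NCt P t}) ⟨hj, h⟩

lemma card_loweringStarts_succ (h0 : pathN B 0 = NCt P 0) {k : ℕ}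
    (hge : ∀ i ≤ k, NCt P i ≤ pathN B i) :
    (loweringStarts P B (k + 1)).card =
      ∑ i ∈ Icc 1 k, if k + 1 ∉ B ∧ lastTouch P B k < i ∧
        k < i + (pathN B k - pathN B (lastTouch P B k)) then 1 else 0 := by
  obtain ⟨hs, hst⟩ := lastTouch_mem h0 k
  have hle := fun j (hj : j ≤ k) h => le_lastTouch (P := P) (B := B) hj h
  set s := lastTouch P B k
  have hN := card_filter_mem_Ioc B hs
  have hE := card_filter_notMem_Ioc B hs
  rw [← card_filter]
  by_cases hk : k + 1 ∈ B
  · simp [hk, loweringStarts]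
  have h1 : loweringStarts P B (k + 1) = (Ioc s k).filter (· ∈ B) := by
    ext e
    simp only [loweringStarts, mem_filter, mem_Ico, mem_Ioc]
    constructor
    · rintro ⟨he, -, heB, h⟩
      refine ⟨⟨?_, by omega⟩, heB⟩
      by_contra hse
      have := h s (by omega)
      omega
    · rintro ⟨he, heB⟩
      refine ⟨by omega, hk, heB, fun i hi => ?_⟩
      refine lt_of_le_of_ne (hge i (by omega)) fun h => ?_
      have := hle i (by omega) h.symm
      omega
  have h2 : ((Icc 1 k).filter fun i => k + 1 ∉ B ∧ s < i ∧ k < i + (pathN B k - pathN B s)) =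
      Ioc (k - (pathN B k - pathN B s)) k := by
    ext i
    simp only [mem_filter, mem_Icc, mem_Ioc]
    constructor
    · rintro ⟨_, -, _, _⟩
      omega
    · intro _
      exact ⟨by omega, hk, by omega, by omega⟩
  rw [h1, h2, Nat.card_Ioc]
  omega

lemma min_card_succ (h0 : pathN B 0 = NCt P 0) (hn : pathN B n = NCt P n) {k i : ℕ}
    (hk : k ≤ n) (hi : i ≤ k) :
    min (pathN B i - pathN B (lastTouch P B i))
        ((Ioc i (min (nextTouch P B i) (k + 1))).filter (· ∉ B)).card =
      min (pathN B i - pathN B (lastTouch P B i))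
        ((Ioc i (min (nextTouch P B i) k)).filter (· ∉ B)).card +
      if k + 1 ∉ B ∧ lastTouch P B k < i ∧
        k < i + (pathN B k - pathN B (lastTouch P B k)) then 1 else 0 := by
  obtain ⟨ht, htt⟩ := nextTouch_mem hn (hi.trans hk)
  obtain ⟨hs, hst⟩ := lastTouch_mem h0 k
  obtain ⟨hs', hst'⟩ := lastTouch_mem h0 i
  by_cases h : nextTouch P B i ≤ k
  · have := le_lastTouch h htt
    rw [if_neg (by omega), min_eq_left h, min_eq_left (h.trans k.le_succ), add_zero]
  · have hlt : lastTouch P B k < i := by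
      by_contra hc
      have := nextTouch_le (not_lt.1 hc) hst
      omega
    have heq : lastTouch P B i = lastTouch P B k :=
      le_antisymm (le_lastTouch (by omega) hst') (le_lastTouch hlt.le hst)
    rw [heq, min_eq_right (not_le.1 h).le, min_eq_right (show k + 1 ≤ _ from not_le.1 h)]
    have e1 := card_filter_notMem_Ioc B hi
    have e2 := card_filter_notMem_Ioc B (hi.trans (Nat.le_succ k))
    have e3 := card_filter_mem_Ioc B hi
    have e4 := card_filter_mem_Ioc B hlt.le
    have e5 := pathN_succ B k
    rw [Nat.succ_eq_add_one] at e2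
    by_cases hB : k + 1 ∈ B
    · rw [if_pos hB] at e5
      rw [if_neg (by simp [hB])]
      omega
    · rw [if_neg hB] at e5
      simp only [hB, hlt, not_false_eq_true, true_and]
      split_ifs <;> omega

lemma sum_min_card (h0 : pathN B 0 = NCt P 0) (hn : pathN B n = NCt P n)
    (hge : ∀ i ≤ n, NCt P i ≤ pathN B i) {k : ℕ} (hk : k ≤ n) :
    ∑ i ∈ Icc 1 k, min (pathN B i - pathN B (lastTouch P B i))
        ((Ioc i (min (nextTouch P B i) k)).filter (· ∉ B)).card =
      (loweringPairs k P B).card := by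
  unfold loweringPairs
  rw [card_sigma]
  induction k with
  | zero => simp
  | succ k ih =>
    rw [sum_Icc_succ_top (by omega), sum_Icc_succ_top (by omega), ← ih (by omega),
      card_loweringStarts_succ h0 (fun i hi => hge i (by omega)),
      sum_congr rfl fun i hi => min_card_succ h0 hn (by omega) (mem_Icc.1 hi).2, sum_add_distrib,
      Ioc_eq_empty (by omega)]
    simp

/-- The area between the path of `B` and `L'` counts the lowering exchanges of `B`. -/
lemma sum_area_eq_card_loweringPairs (h0 : pathN B 0 = NCt P 0) (hn : pathN B n = NCt P n)
    (hge : ∀ i ≤ n, NCt P i ≤ pathN B i) :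
    ∑ i ∈ Icc 1 n, (pathN B i - NLp P B i) = (loweringPairs n P B).card := by
  rw [← sum_min_card h0 hn hge le_rfl]
  refine sum_congr rfl fun i hi => ?_
  have hi := (mem_Icc.1 hi).2
  obtain ⟨ht, htt⟩ := nextTouch_mem hn hi
  obtain ⟨hs, hst⟩ := lastTouch_mem h0 i
  have := nextTouch_le hi hn
  have e1 := card_filter_notMem_Ioc B ht
  have e2 := card_filter_mem_Ioc B ht
  have e3 := card_filter_mem_Ioc B hs
  rw [min_eq_left this, NLp]
  omega

end Touch

section Exchange

variable {m r : ℕ} {P Q : ℕ → Bool} {B B' : Finset ℕ}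

lemma card_exchange {e f : ℕ} (he : e ∈ B) (hf : f ∉ B) :
    (insert f (B.erase e)).card = B.card := by
  rw [card_insert_of_notMem (by simp [hf]), card_erase_add_one he]

lemma exchange_subset {n e f : ℕ} (hB : B ⊆ Icc 1 n) (h1 : 1 ≤ f) (hn : f ≤ n) :
    insert f (B.erase e) ⊆ Icc 1 n :=
  insert_subset (mem_Icc.2 ⟨h1, hn⟩) ((erase_subset _ _).trans hB)

lemma isLPBasis_lower_iff (hB : IsLPBasis m r P Q B) {e f : ℕ} (he : e ∈ B) (hf : f ∉ B)
    (hef : e < f) :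
    IsLPBasis m r P Q (insert f (B.erase e)) ↔
      f ≤ m + r ∧ ∀ i, e ≤ i → i < f → NCt P i < pathN B i := by
  obtain ⟨hs, hc, hb⟩ := hB
  change ∀ i ≤ m + r, NCt P i ≤ pathN B i ∧ pathN B i ≤ NCt Q i at hb
  have hex := pathN_exchange he hf hef
  constructor
  · rintro ⟨hs', -, hb'⟩
    change ∀ i ≤ m + r, NCt P i ≤ pathN _ i ∧ pathN _ i ≤ NCt Q i at hb'
    have hfn := (mem_Icc.1 (hs' (mem_insert_self _ _))).2
    refine ⟨hfn, fun i h1 h2 => ?_⟩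
    have h3 := hb' i (by omega)
    have h4 := hex i
    rw [if_pos ⟨h1, h2⟩] at h4
    omega
  · rintro ⟨hfn, h⟩
    refine ⟨exchange_subset hs (by omega) hfn, (card_exchange he hf).trans hc, fun i hi => ?_⟩
    change NCt P i ≤ pathN _ i ∧ pathN _ i ≤ NCt Q i
    have h3 := hb i hi
    have h4 := hex i
    have h5 := h i
    split_ifs at h4 with h6
    · have := h5 h6.1 h6.2
      omega
    · omega

lemma isLPBasis_raise (hB : IsLPBasis m r P Q B) {e f : ℕ} (he : e ∉ B) (hf : f ∈ B)
    (h1 : 1 ≤ e) (hef : e < f) (h : ∀ i, e ≤ i → i < f → i ≤ m + r → pathN B i < NCt Q i) :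
    IsLPBasis m r P Q (insert e (B.erase f)) := by
  obtain ⟨hs, hc, hb⟩ := hB
  change ∀ i ≤ m + r, NCt P i ≤ pathN B i ∧ pathN B i ≤ NCt Q i at hb
  have hfn := (mem_Icc.1 (hs hf)).2
  refine ⟨exchange_subset hs h1 (by omega), (card_exchange hf he).trans hc, fun i hi => ?_⟩
  change NCt P i ≤ pathN _ i ∧ pathN _ i ≤ NCt Q i
  have hex := pathN_exchange (B := insert e (B.erase f)) (e := e) (f := f) (by simp)
    (by simp [hef.ne']) hef i
  rw [erase_insert (by simp [he]), insert_erase hf] at hex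
  have h3 := hb i hi
  split_ifs at hex with h6
  · have := h i h6.1 h6.2 hi
    omega
  · omega

/-- If the path of `B` is the first of two paths to rise above the other, then a North step can be
transferred between the two, moving them towards each other without crossing. -/
lemma exists_transfer (hB : IsLPBasis m r P Q B) (hB' : IsLPBasis m r P Q B') {p : ℕ}
    (hp : ∀ j < p, pathN B j = pathN B' j) (hlt : pathN B' p < pathN B p) :
    ∃ q, 1 ≤ p ∧ p < q ∧ p ∈ B ∧ p ∉ B' ∧ q ∉ B ∧ q ∈ B' ∧
      ∀ i, p ≤ i → i < q → pathN B' i < pathN B i := by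
  have hex : ∃ q, p < q ∧ pathN B q ≤ pathN B' q := by
    refine ⟨m + r + p + 1, by omega, ?_⟩
    rw [pathN_eq_card hB.1 (by omega), pathN_eq_card hB'.1 (by omega), hB.2.1, hB'.2.1]
  classical
  obtain ⟨hq1, hq2⟩ := Nat.find_spec hex
  have hmin : ∀ i, p ≤ i → i < Nat.find hex → pathN B' i < pathN B i := by
    intro i h1 h2
    have := Nat.find_min hex h2
    rcases h1.eq_or_lt with rfl | h1
    · exact hlt
    · omega
  generalize Nat.find hex = q at *
  obtain rfl | ⟨p, rfl⟩ : p = 0 ∨ ∃ k, p = k + 1 := by cases p <;> simp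
  · rw [pathN_zero hB.1] at hlt
    omega
  obtain ⟨q, rfl⟩ : ∃ k, q = k + 1 := ⟨q - 1, by omega⟩
  have h1 := hp p (by omega)
  have h2 := hmin q (by omega) (by omega)
  have e1 := pathN_succ B p
  have e2 := pathN_succ B' p
  have e3 := pathN_succ B q
  have e4 := pathN_succ B' q
  refine ⟨q + 1, by omega, hq1, ?_, ?_, ?_, ?_, hmin⟩
  all_goals
    by_contra hc
    split_ifs at e1 e2 e3 e4 <;> first | contradiction | omega

end Exchange

section Indicator

variable {n : ℕ} {B B' C : Finset ℕ}

lemma ind_injOn (hB : B ⊆ Icc 1 n) (hB' : B' ⊆ Icc 1 n) (h : ind n B = ind n B') : B = B' := by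
  have key : ∀ j ∈ Icc 1 n, (j ∈ B ↔ j ∈ B') := by
    intro j hj
    rw [mem_Icc] at hj
    have h1 := congrFun h ⟨j - 1, by omega⟩
    simp only [ind, Nat.sub_add_cancel hj.1] at h1
    split_ifs at h1 <;> simp_all
  ext j
  exact ⟨fun hj => (key j (hB hj)).1 hj, fun hj => (key j (hB' hj)).2 hj⟩

/-- No three distinct indicator vectors are collinear. -/
lemma eq_or_eq_of_ind_eq (hB : B ⊆ Icc 1 n) (hB' : B' ⊆ Icc 1 n) (hC : C ⊆ Icc 1 n)
    (hne : B ≠ B') {t : ℝ} (h : ind n C = t • (ind n B' - ind n B) + ind n B) :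
    C = B ∨ C = B' := by
  obtain ⟨i, hi⟩ : ∃ i, ind n B i ≠ ind n B' i := by
    by_contra! hc
    exact hne (ind_injOn hB hB' (funext hc))
  have ht : t = 0 ∨ t = 1 := by
    have h1 := congrFun h i
    simp only [ind, Pi.add_apply, Pi.smul_apply, Pi.sub_apply, smul_eq_mul] at h1 hi
    split_ifs at h1 hi <;> first | (left; linarith) | (right; linarith) | simp at hi
  rcases ht with rfl | rfl
  · exact Or.inl (ind_injOn hC hB (by simpa using h))
  · exact Or.inr (ind_injOn hC hB' (by simpa using h))

lemma eq_or_eq_of_ind_mem_segment (hB : B ⊆ Icc 1 n) (hB' : B' ⊆ Icc 1 n) (hC : C ⊆ Icc 1 n)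
    (hne : B ≠ B') (h : ind n C ∈ segment ℝ (ind n B) (ind n B')) : C = B ∨ C = B' := by
  rw [segment_eq_image'] at h
  obtain ⟨t, -, ht⟩ := h
  exact eq_or_eq_of_ind_eq hB hB' hC hne (t := t) (by rw [← ht, add_comm])

lemma sum_ind (hB : B ⊆ Icc 1 n) : ∑ i, ind n B i = B.card := by
  unfold ind
  rw [Fin.sum_univ_eq_sum_range (fun i => if i + 1 ∈ B then (1 : ℝ) else 0), sum_boole]
  congr 1
  refine card_bij (fun i _ => i + 1) (by simp) (by simp) fun j hj => ?_
  have := mem_Icc.1 (hB hj)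
  exact ⟨j - 1, by simp; grind, by omega⟩

end Indicator

section Polytope

variable {m r : ℕ} {P Q : ℕ → Bool} {B B' : Finset ℕ}

lemma ind_mem_LPMPoly (hB : IsLPBasis m r P Q B) : ind (m + r) B ∈ LPMPoly m r P Q :=
  subset_convexHull ℝ _ ⟨B, hB, rfl⟩

lemma bounds_of_mem_LPMPoly {x : Fin (m + r) → ℝ} (hx : x ∈ LPMPoly m r P Q) :
    (∀ i, 0 ≤ x i ∧ x i ≤ 1) ∧ ∑ i, x i = r := by
  have hc : Convex ℝ {x : Fin (m + r) → ℝ | (∀ i, 0 ≤ x i ∧ x i ≤ 1) ∧ ∑ i, x i = r} := by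
    rintro x ⟨hx, hx'⟩ y ⟨hy, hy'⟩ a b ha hb hab
    refine ⟨fun i => ?_, ?_⟩
    · simp only [Pi.add_apply, Pi.smul_apply, smul_eq_mul]
      obtain ⟨h1, h2⟩ := hx i
      obtain ⟨h3, h4⟩ := hy i
      constructor
      · positivity
      · nlinarith
    · simp only [Pi.add_apply, Pi.smul_apply, smul_eq_mul, sum_add_distrib, ← mul_sum, hx', hy']
      rw [← add_mul, hab, one_mul]
  refine convexHull_min ?_ hc hx
  rintro _ ⟨B, hB, rfl⟩
  refine ⟨fun i => ?_, by rw [sum_ind hB.1, hB.2.1]⟩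
  unfold ind
  split_ifs <;> norm_num

lemma fdim_segment {n : ℕ} {x y : Fin n → ℝ} (h : x ≠ y) : fdim (segment ℝ x y) = 1 := by
  rw [fdim, ← convexHull_pair, affineSpan_convexHull, direction_affineSpan,
    vectorSpan_pair_rev]
  exact finrank_span_singleton (by simpa [sub_eq_zero] using h.symm)

lemma isFace_segment (hB : IsLPBasis m r P Q B) {e f : ℕ} (he : e ∈ B) (hf : f ∉ B)
    (hB' : IsLPBasis m r P Q (insert f (B.erase e))) :
    IsFace (LPMPoly m r P Q) (segment ℝ (ind (m + r) B) (ind (m + r) (insert f (B.erase e)))) := by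
  have he' := mem_Icc.1 (hB.1 he)
  have hf' := mem_Icc.1 (hB'.1 (mem_insert_self _ _))
  have hef : e ≠ f := fun h => hf (h ▸ he)
  have hsame : ∀ i : Fin (m + r), (i : ℕ) + 1 ≠ e → (i : ℕ) + 1 ≠ f →
      ind (m + r) (insert f (B.erase e)) i = ind (m + r) B i := by
    intro i h1 h2
    simp [ind, h1, h2]
  have key : ∀ x ∈ LPMPoly m r P Q, (∀ i : Fin (m + r), (i : ℕ) + 1 ≠ e → (i : ℕ) + 1 ≠ f →
      x i = ind (m + r) B i) →
      x ∈ segment ℝ (ind (m + r) B) (ind (m + r) (insert f (B.erase e))) := by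
    intro x hx h
    obtain ⟨hx1, hx2⟩ := bounds_of_mem_LPMPoly hx
    let a : Fin (m + r) := ⟨e - 1, by omega⟩
    let b : Fin (m + r) := ⟨f - 1, by omega⟩
    have ha : (a : ℕ) + 1 = e := Nat.sub_add_cancel he'.1
    have hb : (b : ℕ) + 1 = f := Nat.sub_add_cancel hf'.1
    have hsum : ∑ i, (x i - ind (m + r) B i) = 0 := by
      rw [sum_sub_distrib, hx2, sum_ind hB.1, hB.2.1, sub_self]
    rw [Fintype.sum_eq_add a b (fun hab => hef (by rw [← ha, ← hb, hab]))
      (fun i hi => sub_eq_zero.2 (h i (fun h => hi.1 (Fin.ext (by omega)))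
        fun h => hi.2 (Fin.ext (by omega))))] at hsum
    simp only [ind, ha, hb, he, hf, if_true, if_false] at hsum
    refine ⟨x a, x b, (hx1 a).1, (hx1 b).1, by linarith, ?_⟩
    ext i
    simp only [Pi.add_apply, Pi.smul_apply, smul_eq_mul]
    by_cases h1 : (i : ℕ) + 1 = e
    · obtain rfl : i = a := Fin.ext (by omega)
      simp [ind, ha, he, hef]
    by_cases h2 : (i : ℕ) + 1 = f
    · obtain rfl : i = b := Fin.ext (by omega)
      simp [ind, hb, hf]
    rw [hsame i h1 h2, h i h1 h2, ← add_mul, show x a + x b = 1 by linarith, one_mul]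
  refine ⟨(convex_convexHull ℝ _).segment_subset (ind_mem_LPMPoly hB) (ind_mem_LPMPoly hB'),
    convex_segment _ _, fun x hx y hy z hz hzF => ?_⟩
  have hfix : ∀ i : Fin (m + r), (i : ℕ) + 1 ≠ e → (i : ℕ) + 1 ≠ f →
      x i = ind (m + r) B i ∧ y i = ind (m + r) B i := by
    intro i h1 h2
    obtain ⟨c, d, -, -, hcd, rfl⟩ := hzF
    obtain ⟨a, b, ha, hb, hab, hz⟩ := hz
    have hzi := congrFun hz i
    simp only [Pi.add_apply, Pi.smul_apply, smul_eq_mul] at hzi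
    rw [hsame i h1 h2, ← add_mul, hcd, one_mul] at hzi
    obtain ⟨hx1, hx2⟩ := (bounds_of_mem_LPMPoly hx).1 i
    obtain ⟨hy1, hy2⟩ := (bounds_of_mem_LPMPoly hy).1 i
    obtain rfl : b = 1 - a := by linarith
    unfold ind at hzi ⊢
    split_ifs at hzi ⊢ <;> constructor <;> nlinarith
  exact ⟨key x hx fun i h1 h2 => (hfix i h1 h2).1, key y hy fun i h1 h2 => (hfix i h1 h2).2⟩

/-- A face of the convex hull of `V` is the convex hull of the points of `V` it contains. -/
lemma face_eq_convexHull {n : ℕ} {V F : Set (Fin n → ℝ)} (hF : IsFace (convexHull ℝ V) F) :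
    F = convexHull ℝ (F ∩ V) := by
  obtain ⟨hsub, hconv, hext⟩ := hF
  refine Set.Subset.antisymm (fun x hx => ?_) (convexHull_min Set.inter_subset_left hconv)
  have hc : Convex ℝ {x | x ∈ convexHull ℝ V ∧ (x ∈ F → x ∈ convexHull ℝ (F ∩ V))} := by
    rw [convex_iff_openSegment_subset]
    rintro x ⟨hx, hx'⟩ y ⟨hy, hy'⟩ z hz
    refine ⟨(convex_convexHull ℝ V).openSegment_subset hx hy hz, fun hzF => ?_⟩
    obtain ⟨h1, h2⟩ := hext x hx y hy z hz hzF
    exact (convex_convexHull ℝ _).openSegment_subset (hx' h1) (hy' h2) hz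
  have hV : V ⊆ {x | x ∈ convexHull ℝ V ∧ (x ∈ F → x ∈ convexHull ℝ (F ∩ V))} := fun v hv =>
    ⟨subset_convexHull ℝ V hv, fun hvF => subset_convexHull ℝ _ ⟨hvF, hv⟩⟩
  exact (convexHull_min hV hc (hsub hx)).2 hx

lemma exists_lower_of_mem_face {F : Set (Fin (m + r) → ℝ)} (hF : IsFace (LPMPoly m r P Q) F)
    (hline : ∀ C, IsLPBasis m r P Q C → ind (m + r) C ∈ F → C = B ∨ C = B')
    (hB : IsLPBasis m r P Q B) (hB' : IsLPBasis m r P Q B')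
    (hBF : ind (m + r) B ∈ F) (hBF' : ind (m + r) B' ∈ F) {p : ℕ}
    (hp : ∀ j < p, pathN B j = pathN B' j) (hlt : pathN B' p < pathN B p) :
    ∃ q, p < q ∧ p ∈ B ∧ q ∉ B ∧ B' = insert q (B.erase p) := by
  obtain ⟨q, h1, hpq, hpB, hpB', hqB, hqB', h⟩ := exists_transfer hB hB' hp hlt
  have hqn := (mem_Icc.1 (hB'.1 hqB')).2
  have hlow : IsLPBasis m r P Q (insert q (B.erase p)) :=
    (isLPBasis_lower_iff hB hpB hqB hpq).2 ⟨hqn, fun i hi hi' =>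
      (hB'.2.2 i (by omega)).1.trans_lt (h i hi hi')⟩
  have hhigh : IsLPBasis m r P Q (insert p (B'.erase q)) :=
    isLPBasis_raise hB' hpB' hqB' h1 hpq fun i hi hi' hi'' =>
      (h i hi hi').trans_le (hB.2.2 i hi'').2
  have hmid : (1 / 2 : ℝ) • ind (m + r) (insert q (B.erase p)) +
      (1 / 2 : ℝ) • ind (m + r) (insert p (B'.erase q)) =
      (1 / 2 : ℝ) • ind (m + r) B + (1 / 2 : ℝ) • ind (m + r) B' := by
    rw [← smul_add, ← smul_add]
    congr 1
    ext i
    simp only [ind, Pi.add_apply, mem_insert, mem_erase]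
    by_cases hi : (i : ℕ) + 1 = p
    · simp [hi, hpB, hpB', hpq.ne]
    by_cases hi' : (i : ℕ) + 1 = q
    · simp [hi', hqB, hqB', hpq.ne']
    simp [hi, hi']
  have hmem := (hF.2.2 _ (ind_mem_LPMPoly hlow) _ (ind_mem_LPMPoly hhigh) _
    ⟨1 / 2, 1 / 2, by norm_num, by norm_num, by norm_num, hmid⟩
    (hF.2.1 hBF hBF' (by norm_num) (by norm_num) (by norm_num))).1
  refine ⟨q, hpq, hpB, hqB, ?_⟩
  rcases hline _ hlow hmem with h2 | h2
  · exact absurd (h2 ▸ mem_insert_self _ _) hqB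
  · exact h2.symm

/-- The one-dimensional faces are the segments joining two bases that differ by one exchange. -/
lemma isEdge_iff {F : Set (Fin (m + r) → ℝ)} :
    IsFace (LPMPoly m r P Q) F ∧ fdim F = 1 ↔
      ∃ B e f, IsLPBasis m r P Q B ∧ e ∈ B ∧ f ∉ B ∧ e < f ∧
        IsLPBasis m r P Q (insert f (B.erase e)) ∧
        F = segment ℝ (ind (m + r) B) (ind (m + r) (insert f (B.erase e))) := by
  constructor
  · rintro ⟨hF, hdim⟩
    have hhull := face_eq_convexHull hF
    obtain ⟨_, ⟨hBF, B, hB, rfl⟩, _, ⟨hBF', B', hB', rfl⟩, hne⟩ :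
        (F ∩ ind (m + r) '' {B | IsLPBasis m r P Q B}).Nontrivial := by
      rw [← Set.not_subsingleton_iff]
      intro hsub
      rw [fdim, direction_affineSpan, hhull, ← direction_affineSpan, affineSpan_convexHull,
        direction_affineSpan, vectorSpan_of_subsingleton ℝ hsub, finrank_bot] at hdim
      exact zero_ne_one hdim
    replace hne : B ≠ B' := fun h => hne (h ▸ rfl)
    have hline : ∀ C, IsLPBasis m r P Q C → ind (m + r) C ∈ F → C = B ∨ C = B' := by
      intro C hC hCF
      have hcol : Collinear ℝ F := by
        rw [collinear_iff_finrank_le_one, ← direction_affineSpan]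
        exact hdim.le
      obtain ⟨v, hv⟩ := (collinear_iff_of_mem hBF).1 hcol
      obtain ⟨s, hs⟩ := hv _ hBF'
      obtain ⟨t, ht⟩ := hv _ hCF
      rw [vadd_eq_add] at hs ht
      have hs0 : s ≠ 0 := by
        rintro rfl
        exact hne (ind_injOn hB.1 hB'.1 (by simpa using hs.symm))
      refine eq_or_eq_of_ind_eq hB.1 hB'.1 hC.1 hne (t := t / s) ?_
      rw [ht, hs, add_sub_cancel_right, smul_smul, div_mul_cancel₀ _ hs0]
    have hseg : F = segment ℝ (ind (m + r) B) (ind (m + r) B') := by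
      rw [← convexHull_pair, hhull]
      congr 1
      ext x
      constructor
      · rintro ⟨hx, C, hC, rfl⟩
        rcases hline C hC hx with rfl | rfl <;> simp
      · rintro (rfl | rfl)
        exacts [⟨hBF, B, hB, rfl⟩, ⟨hBF', B', hB', rfl⟩]
    have hdiff : ∃ p, pathN B p ≠ pathN B' p := by
      by_contra! hc
      refine hne (Finset.ext fun j => ?_)
      rcases j with _ | j
      · have h0 : ∀ {C}, IsLPBasis m r P Q C → 0 ∉ C := fun hC h => by
          have := mem_Icc.1 (hC.1 h)
          omega
        simp [h0 hB, h0 hB']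
      · have h1 := hc (j + 1)
        rw [pathN_succ, pathN_succ, hc j] at h1
        split_ifs at h1 with h2 h3 h3 <;> first | omega | simp [h2, h3]
    classical
    have hspec := Nat.find_spec hdiff
    have hmin : ∀ j < Nat.find hdiff, pathN B j = pathN B' j := fun j hj =>
      not_not.1 (Nat.find_min hdiff hj)
    generalize Nat.find hdiff = p at hspec hmin
    rcases hspec.lt_or_gt with h | h
    · obtain ⟨q, h1, h2, h3, rfl⟩ := exists_lower_of_mem_face hF
        (fun C hC hCF => (hline C hC hCF).symm) hB' hB hBF' hBF (fun j hj => (hmin j hj).symm) h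
      exact ⟨B', _, q, hB', h2, h3, h1, hB, by rw [hseg, segment_symm]⟩
    · obtain ⟨q, h1, h2, h3, rfl⟩ := exists_lower_of_mem_face hF hline hB hB' hBF hBF' hmin h
      exact ⟨B, _, q, hB, h2, h3, h1, hB', hseg⟩
  · rintro ⟨B, e, f, hB, he, hf, hef, hB', rfl⟩
    refine ⟨isFace_segment hB he hf hB', fdim_segment fun h => hf ?_⟩
    rw [ind_injOn hB.1 hB'.1 h]
    exact mem_insert_self _ _

end Polytope

section Count

variable {m r : ℕ} {P Q : ℕ → Bool} {B B' : Finset ℕ}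

lemma mem_basesFinset : B ∈ basesFinset m r P Q ↔ IsLPBasis m r P Q B := by
  classical
  simp only [basesFinset, mem_filter, mem_powerset, and_iff_right_iff_imp]
  exact fun h => h.1

lemma mem_loweringPairs (hB : IsLPBasis m r P Q B) {e f : ℕ} :
    (⟨f, e⟩ : Σ _ : ℕ, ℕ) ∈ loweringPairs (m + r) P B ↔
      e ∈ B ∧ f ∉ B ∧ e < f ∧ IsLPBasis m r P Q (insert f (B.erase e)) := by
  simp only [loweringPairs, loweringStarts, mem_sigma, mem_filter, mem_Icc, mem_Ico]
  constructor
  · rintro ⟨⟨_, hfn⟩, ⟨_, hef⟩, hf, he, h⟩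
    exact ⟨he, hf, hef, (isLPBasis_lower_iff hB he hf hef).2 ⟨hfn, fun i h1 h2 => h i ⟨h1, h2⟩⟩⟩
  · rintro ⟨he, hf, hef, h⟩
    obtain ⟨hfn, h⟩ := (isLPBasis_lower_iff hB he hf hef).1 h
    have := mem_Icc.1 (hB.1 he)
    exact ⟨⟨by omega, hfn⟩, ⟨this.1, hef⟩, hf, he, fun i hi => h i hi.1 hi.2⟩

lemma sum_lt_sum_exchange {e f : ℕ} (he : e ∈ B) (hf : f ∉ B) (hef : e < f) :
    ∑ j ∈ B, j < ∑ j ∈ insert f (B.erase e), j := by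
  rw [sum_insert (by simp [hf]), ← add_sum_erase B (fun j => j) he]
  exact Nat.add_lt_add_right hef _

lemma exchange_inj {e f e' f' : ℕ} (he : e ∈ B) (hf : f ∉ B)
    (h : insert f (B.erase e) = insert f' (B.erase e')) : e = e' ∧ f = f' := by
  constructor
  · by_contra hne
    have : e ∈ insert f (B.erase e) := h ▸ by simp [hne, he]
    simp only [mem_insert, mem_erase, ne_eq, not_true_eq_false, false_and, or_false] at this
    exact hf (this ▸ he)
  · have : f ∈ insert f' (B.erase e') := h ▸ mem_insert_self _ _
    simpa [hf] using this

/-- The segment joining a basis to its image under a lowering exchange. -/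
def exchangeSegment (n : ℕ) (x : Σ _ : Finset ℕ, Σ _ : ℕ, ℕ) : Set (Fin n → ℝ) :=
  segment ℝ (ind n x.1) (ind n (insert x.2.1 (x.1.erase x.2.2)))

lemma exchangeSegment_injOn :
    Set.InjOn (exchangeSegment (m + r))
      ((basesFinset m r P Q).sigma (loweringPairs (m + r) P) : Set _) := by
  rintro ⟨B, f, e⟩ hx ⟨B', f', e'⟩ hx' h
  rw [mem_coe, mem_sigma, mem_basesFinset] at hx hx'
  obtain ⟨hB, hx⟩ := hx
  obtain ⟨hB', hx'⟩ := hx'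
  obtain ⟨he, hf, hef, hC⟩ := (mem_loweringPairs hB).1 hx
  obtain ⟨he', hf', hef', hC'⟩ := (mem_loweringPairs hB').1 hx'
  simp only [exchangeSegment] at h
  have hlt := sum_lt_sum_exchange he hf hef
  have hlt' := sum_lt_sum_exchange he' hf' hef'
  have hne : B ≠ insert f (B.erase e) := fun hc => hf (hc ▸ mem_insert_self _ _)
  have h1 := eq_or_eq_of_ind_mem_segment hB.1 hC.1 hB'.1 hne (h ▸ left_mem_segment ℝ _ _)
  have h2 := eq_or_eq_of_ind_mem_segment hB.1 hC.1 hC'.1 hne (h ▸ right_mem_segment ℝ _ _)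
  rcases h1 with rfl | h1
  · rcases h2 with h2 | h2
    · exact absurd hlt' (by rw [h2]; exact lt_irrefl _)
    · obtain ⟨rfl, rfl⟩ := exchange_inj he' hf' h2
      rfl
  · rcases h2 with h2 | h2
    · rw [h2, h1] at hlt'
      exact absurd hlt' hlt.asymm
    · rw [h2, h1] at hlt'
      exact absurd hlt' (lt_irrefl _)

lemma setOf_edges_eq :
    {F : Set (Fin (m + r) → ℝ) | IsFace (LPMPoly m r P Q) F ∧ fdim F = 1} =
      exchangeSegment (m + r) '' ((basesFinset m r P Q).sigma (loweringPairs (m + r) P)) := by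
  ext F
  rw [Set.mem_ofPred_eq, isEdge_iff]
  constructor
  · rintro ⟨B, e, f, hB, he, hf, hef, hC, rfl⟩
    exact ⟨⟨B, f, e⟩, by
      rw [mem_coe, mem_sigma, mem_basesFinset]
      exact ⟨hB, (mem_loweringPairs hB).2 ⟨he, hf, hef, hC⟩⟩, rfl⟩
  · rintro ⟨⟨B, f, e⟩, hx, rfl⟩
    rw [mem_coe, mem_sigma, mem_basesFinset] at hx
    obtain ⟨hB, hx⟩ := hx
    obtain ⟨he, hf, hef, hC⟩ := (mem_loweringPairs hB).1 hx
    exact ⟨B, e, f, hB, he, hf, hef, hC, rfl⟩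

end Count

end LatticePathMatroid

/-- The number of edges of the lattice path matroid polytope equals the sum, over
all lattice paths `L` from `(0,0)` to `(m,r)` inside `[P,Q]`, of the area between
`L'` and `L`. -/
theorem lpm_edge_count (m r : ℕ) (P Q : ℕ → Bool)
    (hP : IsPath m r P) (hQ : IsPath m r Q) (hPQ : Below (m + r) P Q) :
    Nat.card {F : Set (Fin (m + r) → ℝ) | IsFace (LPMPoly m r P Q) F ∧ fdim F = 1} =
      ∑ B ∈ basesFinset m r P Q, ∑ i ∈ Finset.Icc 1 (m + r), (pathN B i - NLp P B i) := by
  rw [LatticePathMatroid.setOf_edges_eq, Nat.card_coe_set_eq,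
    LatticePathMatroid.exchangeSegment_injOn.ncard_image, Set.ncard_coe_finset,
    Finset.card_sigma]
  refine Finset.sum_congr rfl fun B hB => ?_
  have hB := LatticePathMatroid.mem_basesFinset.1 hB
  refine (LatticePathMatroid.sum_area_eq_card_loweringPairs ?_ ?_ fun i hi => (hB.2.2 i hi).1).symm
  · rw [LatticePathMatroid.pathN_zero hB.1]
    simp [NCt]
  · rw [LatticePathMatroid.pathN_eq_card hB.1 le_rfl, hB.2.1, hP]
end
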